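/- arXiv:1911.12940 — 6 statements merged into one kernel-verified Lean document; each statement's English description precedes it below -/
import Mathlib

section
/- Let X be a regular T2 space and let 𝒫 be a k-network of X. Then the family ℬ = {⟨P₁,...,P_r⟩ : P₁,...,P_r ∈ 𝒫, r ∈ ℕ} is a k-network of the hyperspace 𝒦(X) with the Vietoris topology. -/
open TopologicalSpace Set

/-- The hyperspace `𝒦(X)` of nonempty compact subsets of `X`. -/
structure VHyper (X : Type*) [TopologicalSpace X] where
  carrier : Set X
  isCompact' : IsCompact carrier
  nonempty' : carrier.Nonempty

namespace VHyper

variable {X : Type*} [TopologicalSpace X]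

/-- The basic Vietoris set `⟨P₁, …, P_r⟩` determined by a finite family of subsets of `X`:
all nonempty compact sets contained in the union and meeting every member. -/
def vbox (Ps : Finset (Set X)) : Set (VHyper X) :=
  {A : VHyper X | A.carrier ⊆ ⋃₀ (Ps : Set (Set X)) ∧ ∀ P ∈ Ps, (A.carrier ∩ P).Nonempty}

/-- The Vietoris topology on `𝒦(X)`, generated by the sets `⟨U₁, …, U_k⟩`
with all `U_i` open. -/
instance : TopologicalSpace (VHyper X) :=
  TopologicalSpace.generateFrom
    {S : Set (VHyper X) | ∃ Ps : Finset (Set X), (∀ U ∈ Ps, IsOpen U) ∧ S = vbox Ps}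

end VHyper

/-- `ℱ(X)`: the subspace of `𝒦(X)` consisting of the nonempty finite subsets of `X`. -/
def VFin (X : Type*) [TopologicalSpace X] := {A : VHyper X // A.carrier.Finite}

instance (X : Type*) [TopologicalSpace X] : TopologicalSpace (VFin X) :=
  inferInstanceAs (TopologicalSpace {A : VHyper X // A.carrier.Finite})

/-- `ℱ₂(X)`: the subspace of `𝒦(X)` consisting of the nonempty subsets of `X` of
cardinality at most 2. -/
def VFin2 (X : Type*) [TopologicalSpace X] := {A : VHyper X // A.carrier.encard ≤ 2}

instance (X : Type*) [TopologicalSpace X] : TopologicalSpace (VFin2 X) :=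
  inferInstanceAs (TopologicalSpace {A : VHyper X // A.carrier.encard ≤ 2})

/-- The family `ℬ = {⟨P₁,…,P_r⟩ : P₁,…,P_r ∈ Pfam, r ∈ ℕ}` of basic Vietoris sets built from
members of `Pfam`. -/
def boxFamily {X : Type*} [TopologicalSpace X] (Pfam : Set (Set X)) : Set (Set (VHyper X)) :=
  {B | ∃ Ps : Finset (Set X), Ps.Nonempty ∧ ↑Ps ⊆ Pfam ∧ B = VHyper.vbox Ps}

section Defs

variable {Y : Type*} [TopologicalSpace Y]

/-- `Pfam` is a k-network: for every compact `C` and open `U ⊇ C` there is a finite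
subfamily `Qfam ⊆ Pfam` with `C ⊆ ⋃Qfam ⊆ U`. -/
def IsKNetwork (Pfam : Set (Set Y)) : Prop :=
  ∀ C : Set Y, IsCompact C → ∀ U : Set Y, IsOpen U → C ⊆ U →
    ∃ Qfam : Set (Set Y), Qfam ⊆ Pfam ∧ Qfam.Finite ∧ C ⊆ ⋃₀ Qfam ∧ ⋃₀ Qfam ⊆ U

/-- Every point lies in at most countably many members of `Pfam`. -/
def PointCountableFam (Pfam : Set (Set Y)) : Prop :=
  ∀ y : Y, {P ∈ Pfam | y ∈ P}.Countable

/-- Every compact set meets at most countably many members of `Pfam`. -/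
def CompactCountableFam (Pfam : Set (Set Y)) : Prop :=
  ∀ C : Set Y, IsCompact C → {P ∈ Pfam | (C ∩ P).Nonempty}.Countable

/-- Every point has a neighborhood meeting at most countably many members of `Pfam`. -/
def LocallyCountableFam (Pfam : Set (Set Y)) : Prop :=
  ∀ y : Y, ∃ O ∈ nhds y, {P ∈ Pfam | (O ∩ P).Nonempty}.Countable

/-- Every point has a neighborhood meeting only finitely many members of `Pfam`. -/
def LocallyFiniteFam (Pfam : Set (Set Y)) : Prop :=
  ∀ y : Y, ∃ O ∈ nhds y, {P ∈ Pfam | (O ∩ P).Nonempty}.Finite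

/-- Every compact set meets only finitely many members of `Pfam`. -/
def CompactFiniteFam (Pfam : Set (Set Y)) : Prop :=
  ∀ C : Set Y, IsCompact C → {P ∈ Pfam | (C ∩ P).Nonempty}.Finite

/-- `Pfam` is a base for the topology: all members are open, and every open set is a union of
members around each of its points. -/
def IsBaseFam (Pfam : Set (Set Y)) : Prop :=
  (∀ P ∈ Pfam, IsOpen P) ∧ ∀ U : Set Y, IsOpen U → ∀ y ∈ U, ∃ P ∈ Pfam, y ∈ P ∧ P ⊆ U

/-- `Pfam` is hereditarily closure-preserving: whenever `S P ⊆ P` is chosen for each `P ∈ Pfam`,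
the resulting family is closure-preserving. -/
def IsHCP (Pfam : Set (Set Y)) : Prop :=
  ∀ S : Set Y → Set Y, (∀ P ∈ Pfam, S P ⊆ P) →
    ∀ Qfam ⊆ Pfam, closure (⋃ P ∈ Qfam, S P) = ⋃ P ∈ Qfam, closure (S P)

/-- `Pfam = ⋃_{y} Pfam y` is a weak base: each `Pfam y` consists of sets containing `y`, is directed
downward, every open neighborhood of `y` contains a member of `Pfam y`, and a set `G` is open
whenever each of its points has a member of its family inside `G`. -/
def IsWeakBase (Pfam : Y → Set (Set Y)) : Prop :=
  (∀ y, ∀ P ∈ Pfam y, y ∈ P) ∧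
  (∀ y, ∀ U ∈ Pfam y, ∀ V ∈ Pfam y, ∃ W ∈ Pfam y, W ⊆ U ∩ V) ∧
  (∀ y, ∀ U : Set Y, IsOpen U → y ∈ U → ∃ P ∈ Pfam y, P ⊆ U) ∧
  (∀ G : Set Y, (∀ y ∈ G, ∃ P ∈ Pfam y, P ⊆ G) → IsOpen G)

end Defs

/-- An ℵ-space: a space with a σ-locally finite k-network. -/
def IsAlephSpace (Y : Type*) [TopologicalSpace Y] : Prop :=
  ∃ Pfam : ℕ → Set (Set Y), (∀ n, LocallyFiniteFam (Pfam n)) ∧ IsKNetwork (⋃ n, Pfam n)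

/-- A space with a σ-hereditarily closure-preserving k-network. -/
def HasSigmaHCPKNetwork (Y : Type*) [TopologicalSpace Y] : Prop :=
  ∃ Pfam : ℕ → Set (Set Y), (∀ n, IsHCP (Pfam n)) ∧ IsKNetwork (⋃ n, Pfam n)

/-- k*-metrizable: a space with a σ-compact-finite k-network. -/
def KStarMetrizable (Y : Type*) [TopologicalSpace Y] : Prop :=
  ∃ Pfam : ℕ → Set (Set Y), (∀ n, CompactFiniteFam (Pfam n)) ∧ IsKNetwork (⋃ n, Pfam n)

open Topology

theorem VHyper.isOpen_sub {X : Type*} [TopologicalSpace X] {W : Set X} (hW : IsOpen W) :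
    IsOpen {K : VHyper X | K.carrier ⊆ W} := by
  apply TopologicalSpace.isOpen_generateFrom_of_mem
  refine ⟨{W}, by simpa using hW, ?_⟩
  ext K
  simp only [VHyper.vbox, mem_setOf_eq, Finset.coe_singleton, sUnion_singleton,
    Finset.mem_singleton, forall_eq]
  refine ⟨fun h => ⟨h, ?_⟩, fun h => h.1⟩
  rw [inter_eq_left.2 h]
  exact K.nonempty'

theorem VHyper.isOpen_meets {X : Type*} [TopologicalSpace X] {W : Set X} (hW : IsOpen W) :
    IsOpen {K : VHyper X | (K.carrier ∩ W).Nonempty} := by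
  classical
  apply TopologicalSpace.isOpen_generateFrom_of_mem
  refine ⟨{univ, W}, by simpa using hW, ?_⟩
  ext K
  simp [VHyper.vbox, K.nonempty']

theorem VHyper.exists_base {X : Type*} [TopologicalSpace X] {U : Set (VHyper X)} (hU : IsOpen U) :
    ∀ K ∈ U, ∃ (W : Set X) (Ps : Set (Set X)), IsOpen W ∧ Ps.Finite ∧ (∀ P ∈ Ps, IsOpen P) ∧
      K.carrier ⊆ W ∧ (∀ P ∈ Ps, (K.carrier ∩ P).Nonempty) ∧
      ∀ K' : VHyper X, K'.carrier ⊆ W → (∀ P ∈ Ps, (K'.carrier ∩ P).Nonempty) → K' ∈ U := by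
  induction hU with
  | basic S hS =>
    obtain ⟨Ps, hPs, rfl⟩ := hS
    intro K hK
    exact ⟨⋃₀ (Ps : Set (Set X)), Ps, isOpen_sUnion (by simpa using hPs), Ps.finite_toSet,
      by simpa using hPs, hK.1, by simpa using hK.2, fun K' h1 h2 => ⟨h1, by simpa using h2⟩⟩
  | univ => 
    intro K _
    exact ⟨univ, ∅, isOpen_univ, finite_empty, by simp, subset_univ _, by simp, by simp⟩
  | inter S T _ _ ihS ihT =>
    intro K hK
    obtain ⟨W, Ps, h1, h2, h3, h4, h5, h6⟩ := ihS K hK.1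
    obtain ⟨W', Ps', h1', h2', h3', h4', h5', h6'⟩ := ihT K hK.2
    refine ⟨W ∩ W', Ps ∪ Ps', h1.inter h1', h2.union h2', ?_, subset_inter h4 h4', ?_, ?_⟩
    · rintro P (hP | hP)
      exacts [h3 P hP, h3' P hP]
    · rintro P (hP | hP)
      exacts [h5 P hP, h5' P hP]
    · intro K' hW hP
      exact ⟨h6 K' (hW.trans inter_subset_left) fun P h => hP P (Or.inl h),
        h6' K' (hW.trans inter_subset_right) fun P h => hP P (Or.inr h)⟩
  | sUnion S _ ih =>
    rintro K ⟨T, hT, hK⟩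
    obtain ⟨W, Ps, h1, h2, h3, h4, h5, h6⟩ := ih T hT K hK
    exact ⟨W, Ps, h1, h2, h3, h4, h5, fun K' a b => ⟨T, hT, h6 K' a b⟩⟩

theorem VHyper.isCompact_union {X : Type*} [TopologicalSpace X] {C : Set (VHyper X)}
    (hC : IsCompact C) : IsCompact (⋃ K ∈ C, K.carrier) := by
  classical
  apply isCompact_of_finite_subcover
  intro ι V hV hcov
  suffices H : ∃ t : Finset ι, ∀ K ∈ C, K.carrier ⊆ ⋃ i ∈ t, V i by
    obtain ⟨t, ht⟩ := H
    exact ⟨t, iUnion₂_subset ht⟩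
  refine hC.induction_on (p := fun S => ∃ t : Finset ι, ∀ K ∈ S, K.carrier ⊆ ⋃ i ∈ t, V i)
    ⟨∅, by simp⟩ ?_ ?_ ?_
  · rintro S T hST ⟨t, ht⟩
    exact ⟨t, fun K hK => ht K (hST hK)⟩
  · rintro S T ⟨s, hs⟩ ⟨t, ht⟩
    refine ⟨s ∪ t, ?_⟩
    rintro K (hK | hK)
    · exact (hs K hK).trans (biUnion_subset_biUnion_left fun i hi => Finset.mem_union_left _ hi)
    · exact (ht K hK).trans (biUnion_subset_biUnion_left fun i hi => Finset.mem_union_right _ hi)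
  · intro K hK
    obtain ⟨t, ht⟩ := K.isCompact'.elim_finite_subcover V hV
      ((subset_biUnion_of_mem (u := fun K : VHyper X => K.carrier) hK).trans hcov)
    exact ⟨{K' | K'.carrier ⊆ ⋃ i ∈ t, V i}, mem_nhdsWithin_of_mem_nhds
      ((VHyper.isOpen_sub (isOpen_biUnion fun i _ => hV i)).mem_nhds ht), t, fun K h => h⟩

/-- If `Pfam` is a k-network of `X`, then the family
`ℬ = {⟨P₁,…,P_r⟩ : Pᵢ ∈ Pfam, r ∈ ℕ}` is a k-network of `𝒦(X)`. -/
theorem statement0 {X : Type*} [TopologicalSpace X] [T2Space X] [RegularSpace X]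
    (Pfam : Set (Set X)) (h : IsKNetwork Pfam) :
    IsKNetwork (boxFamily Pfam) := by
  classical
  intro C hC U hU hCU
  have hL := VHyper.isCompact_union hC
  set L := ⋃ K ∈ C, K.carrier with hLdef
  have hKL : ∀ K ∈ C, K.carrier ⊆ L := fun K hK =>
    subset_biUnion_of_mem (u := fun K : VHyper X => K.carrier) hK
  suffices H : ∃ Qfam : Set (Set (VHyper X)), Qfam ⊆ boxFamily Pfam ∧ Qfam.Finite ∧
      C ∩ C ⊆ ⋃₀ Qfam ∧ ⋃₀ Qfam ⊆ U by rwa [inter_self] at H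
  refine hC.induction_on (p := fun S => ∃ Qfam : Set (Set (VHyper X)), Qfam ⊆ boxFamily Pfam ∧
    Qfam.Finite ∧ C ∩ S ⊆ ⋃₀ Qfam ∧ ⋃₀ Qfam ⊆ U) ⟨∅, by simp⟩ ?_ ?_ ?_
  · rintro S T hST ⟨Q, h1, h2, h3, h4⟩
    exact ⟨Q, h1, h2, (inter_subset_inter_right _ hST).trans h3, h4⟩
  · rintro S T ⟨Q, h1, h2, h3, h4⟩ ⟨Q', h1', h2', h3', h4'⟩
    refine ⟨Q ∪ Q', union_subset h1 h1', h2.union h2', ?_, ?_⟩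
    · rw [inter_union_distrib_left, sUnion_union]
      exact union_subset_union h3 h3'
    · rw [sUnion_union]
      exact union_subset h4 h4'
  · intro K hK
    obtain ⟨W, Ps, hW, hPf, hPo, hKW, hKP, hin⟩ := VHyper.exists_base hU K (hCU hK)
    obtain ⟨W', hW', hKW', hcl⟩ : ∃ W' : Set X, IsOpen W' ∧ K.carrier ⊆ W' ∧ closure W' ⊆ W :=
      K.isCompact'.exists_isOpen_closure_subset (hW.mem_nhdsSet.2 hKW)
    have hV : ∀ P ∈ Ps, ∃ V : Set X, IsOpen V ∧ (K.carrier ∩ V).Nonempty ∧ closure V ⊆ P := by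
      intro P hP
      obtain ⟨x, hxK, hxP⟩ := hKP P hP
      obtain ⟨F, hF, hFc, hFP⟩ := exists_mem_nhds_isClosed_subset ((hPo P hP).mem_nhds hxP)
      exact ⟨interior F, isOpen_interior, ⟨x, hxK, mem_interior_iff_mem_nhds.2 hF⟩,
        (closure_minimal interior_subset hFc).trans hFP⟩
    choose! V hVo hVK hVP using hV
    obtain ⟨Q0, hQ0, hQ0f, hQ0c, hQ0W⟩ := h (L ∩ closure W') (hL.inter_right isClosed_closure) W hW
      (inter_subset_right.trans hcl)
    have hQ : ∀ P ∈ Ps, ∃ Q : Set (Set X), Q ⊆ Pfam ∧ Q.Finite ∧ L ∩ closure (V P) ∩ closure W' ⊆ ⋃₀ Q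
        ∧ ⋃₀ Q ⊆ P ∩ W := fun P hP =>
      h _ ((hL.inter_right isClosed_closure).inter_right isClosed_closure) _ ((hPo P hP).inter hW)
        (fun x hx => ⟨hVP P hP hx.1.2, hcl hx.2⟩)
    choose! Q hQs hQf hQc hQP using hQ
    set R : Set (Set X) := Q0 ∪ ⋃ P ∈ Ps, Q P with hR
    have hRf : R.Finite := hQ0f.union (hPf.biUnion hQf)
    have hRs : R ⊆ Pfam := union_subset hQ0 (iUnion₂_subset hQs)
    have hRW : ∀ A ∈ R, A ⊆ W := by
      rintro A (hA | hA)
      · exact (subset_sUnion_of_mem hA).trans hQ0W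
      · obtain ⟨P, hP, hA⟩ := mem_iUnion₂.1 hA
        exact ((subset_sUnion_of_mem hA).trans (hQP P hP)).trans inter_subset_right
    refine ⟨{K' | K'.carrier ⊆ W'} ∩ ⋂ P ∈ Ps, {K' | (K'.carrier ∩ V P).Nonempty},
      mem_nhdsWithin_of_mem_nhds (IsOpen.mem_nhds ((VHyper.isOpen_sub hW').inter
        (hPf.isOpen_biInter fun P hP => VHyper.isOpen_meets (hVo P hP)))
        ⟨hKW', mem_iInter₂.2 hVK⟩),
      {B | ∃ T ∈ hRf.toFinset.powerset, T.Nonempty ∧ B = VHyper.vbox T ∧ B ⊆ U}, ?_, ?_, ?_, ?_⟩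
    · rintro B ⟨T, hT, hne, hB, -⟩
      refine ⟨T, hne, fun A hA => hRs ?_, hB⟩
      simpa using (Finset.mem_powerset.1 hT) hA
    · refine (hRf.toFinset.powerset.finite_toSet.image VHyper.vbox).subset ?_
      rintro B ⟨T, hT, -, rfl, -⟩
      exact ⟨T, hT, rfl⟩
    · rintro K' ⟨hK'C, hK'W, hK'V⟩
      have hK'V : ∀ P ∈ Ps, (K'.carrier ∩ V P).Nonempty := mem_iInter₂.1 hK'V
      have hK'W : K'.carrier ⊆ W' := hK'W
      have hcov : ∀ x ∈ K'.carrier, ∃ A ∈ R, x ∈ A := by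
        intro x hx
        obtain ⟨A, hA, hxA⟩ := hQ0c ⟨hKL K' hK'C hx, subset_closure (hK'W hx)⟩
        exact ⟨A, Or.inl hA, hxA⟩
      set T := hRf.toFinset.filter fun A => (K'.carrier ∩ A).Nonempty with hT
      have hmT : ∀ A, A ∈ T ↔ A ∈ R ∧ (K'.carrier ∩ A).Nonempty := by
        intro A; simp [hT]
      refine ⟨VHyper.vbox T, ⟨T, by simp [hT], ?_, rfl, ?_⟩, ?_, ?_⟩
      · obtain ⟨x, hx⟩ := K'.nonempty'
        obtain ⟨A, hA, hxA⟩ := hcov x hx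
        exact ⟨A, (hmT A).2 ⟨hA, x, hx, hxA⟩⟩
      · rintro M ⟨hM1, hM2⟩
        apply hin
        · exact hM1.trans (sUnion_subset fun A hA => hRW A ((hmT A).1 hA).1)
        · intro P hP
          obtain ⟨x, hxK, hxV⟩ := hK'V P hP
          obtain ⟨A, hA, hxA⟩ := hQc P hP
            ⟨⟨hKL K' hK'C hxK, subset_closure hxV⟩, subset_closure (hK'W hxK)⟩
          have hAT : A ∈ T := (hmT A).2 ⟨Or.inr (mem_iUnion₂.2 ⟨P, hP, hA⟩), x, hxK, hxA⟩
          exact (hM2 A hAT).mono (inter_subset_inter_right _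
            (((subset_sUnion_of_mem hA).trans (hQP P hP)).trans inter_subset_left))
      · intro x hx
        obtain ⟨A, hA, hxA⟩ := hcov x hx
        exact ⟨A, (hmT A).2 ⟨hA, x, hx, hxA⟩, hxA⟩
      · intro A hA
        exact ((hmT A).1 hA).2
    · rintro M ⟨B, ⟨T, -, -, -, hB⟩, hM⟩
      exact hB hM
end

section
/- A regular T2 space X has a compact-countable k-network (respectively, a compact-countable closed k-network) if and only if the hyperspace 𝒦(X) with the Vietoris topology has a compact-countable k-network (respectively, a compact-countable closed k-network). -/
open TopologicalSpace Set

namespace VHyper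

variable {X : Type*} [TopologicalSpace X]

theorem isOpen_sub_s2 {U : Set X} (hU : IsOpen U) : IsOpen {A : VHyper X | A.carrier ⊆ U} := by
  apply TopologicalSpace.isOpen_generateFrom_of_mem
  refine ⟨{U}, by simpa using hU, ?_⟩
  ext A
  simp only [vbox, mem_setOf_eq, Finset.coe_singleton, sUnion_singleton, Finset.mem_singleton,
    forall_eq]
  refine ⟨fun h => ⟨h, ?_⟩, fun h => h.1⟩
  rw [inter_eq_left.2 h]
  exact A.nonempty'

theorem isOpen_meet {U : Set X} (hU : IsOpen U) :
    IsOpen {A : VHyper X | (A.carrier ∩ U).Nonempty} := by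
  classical
  apply TopologicalSpace.isOpen_generateFrom_of_mem
  refine ⟨{U, univ}, by simpa using hU, ?_⟩
  ext A
  simp [vbox, A.nonempty']

theorem exists_basic {S : Set (VHyper X)} (hS : IsOpen S) (A : VHyper X) (hA : A ∈ S) :
    ∃ (U : Set X) (Ps : Set (Set X)), IsOpen U ∧ Ps.Finite ∧ (∀ P ∈ Ps, IsOpen P) ∧
      A.carrier ⊆ U ∧ (∀ P ∈ Ps, (A.carrier ∩ P).Nonempty) ∧
      ∀ B : VHyper X, B.carrier ⊆ U → (∀ P ∈ Ps, (B.carrier ∩ P).Nonempty) → B ∈ S := by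
  induction hS with
  | basic s hs =>
    obtain ⟨Ps, ho, rfl⟩ := hs
    exact ⟨⋃₀ Ps, Ps, isOpen_sUnion ho, Ps.finite_toSet, ho, hA.1, hA.2, fun B h1 h2 => ⟨h1, h2⟩⟩
  | univ => exact ⟨univ, ∅, isOpen_univ, finite_empty, by simp, by simp, by simp, by simp⟩
  | inter s t _ _ ihs iht =>
    obtain ⟨U, Ps, h1, h2, h3, h4, h5, h6⟩ := ihs hA.1
    obtain ⟨U', Ps', h1', h2', h3', h4', h5', h6'⟩ := iht hA.2
    refine ⟨U ∩ U', Ps ∪ Ps', h1.inter h1', h2.union h2', ?_, subset_inter h4 h4', ?_, ?_⟩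
    · rintro P (h | h)
      exacts [h3 P h, h3' P h]
    · rintro P (h | h)
      exacts [h5 P h, h5' P h]
    · intro B hB hP
      exact ⟨h6 B (hB.trans inter_subset_left) fun P h => hP P (Or.inl h),
        h6' B (hB.trans inter_subset_right) fun P h => hP P (Or.inr h)⟩
  | sUnion T _ ih =>
    obtain ⟨t, ht, hAt⟩ := hA
    obtain ⟨U, Ps, h1, h2, h3, h4, h5, h6⟩ := ih t ht hAt
    exact ⟨U, Ps, h1, h2, h3, h4, h5, fun B hB hP => ⟨t, ht, h6 B hB hP⟩⟩

theorem isCompact_union_s2 {C : Set (VHyper X)} (hC : IsCompact C) :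
    IsCompact (⋃ A ∈ C, A.carrier) := by
  classical
  apply isCompact_of_finite_subcover
  intro ι U hU hcov
  refine hC.induction_on (p := fun s => ∃ t : Finset ι, ⋃ A ∈ s, A.carrier ⊆ ⋃ i ∈ t, U i)
    ⟨∅, by simp⟩ ?_ ?_ ?_
  · rintro s s' hss ⟨t, ht⟩
    exact ⟨t, (biUnion_subset_biUnion_left hss).trans ht⟩
  · rintro s s' ⟨t, ht⟩ ⟨t', ht'⟩
    refine ⟨t ∪ t', ?_⟩
    rw [biUnion_union, Finset.set_biUnion_union]
    exact union_subset_union ht ht'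
  · intro A hA
    obtain ⟨t, ht⟩ := A.isCompact'.elim_finite_subcover U hU
      ((subset_biUnion_of_mem (u := fun A : VHyper X => A.carrier) hA).trans hcov)
    refine ⟨{B | B.carrier ⊆ ⋃ i ∈ t, U i}, mem_nhdsWithin_of_mem_nhds
      ((isOpen_sub_s2 (isOpen_biUnion fun i _ => hU i)).mem_nhds ht), t, ?_⟩
    exact iUnion₂_subset fun B hB => hB

theorem isClosed_vbox (Ps : Finset (Set X)) (h : ∀ P ∈ Ps, IsClosed P) :
    IsClosed (vbox Ps) := by
  have e : vbox Ps = {A : VHyper X | (A.carrier ∩ (⋃₀ (Ps : Set (Set X)))ᶜ).Nonempty}ᶜ ∩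
      ⋂ P ∈ Ps, {A : VHyper X | A.carrier ⊆ Pᶜ}ᶜ := by
    ext A
    simp only [vbox, mem_setOf_eq, mem_inter_iff, mem_compl_iff, mem_iInter,
      Set.not_nonempty_iff_eq_empty, ← disjoint_iff_inter_eq_empty, disjoint_compl_right_iff_subset,
      subset_compl_iff_disjoint_right, not_disjoint_iff_nonempty_inter]
  rw [e]
  refine IsClosed.inter ?_ (isClosed_biInter fun P hP => ?_)
  · refine (isOpen_meet ?_).isClosed_compl
    rw [sUnion_eq_biUnion]
    exact (Ps.finite_toSet.isClosed_biUnion h).isOpen_compl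
  · exact (isOpen_sub_s2 (h P hP).isOpen_compl).isClosed_compl

theorem boxFamily_cc {Pfam : Set (Set X)} (h : CompactCountableFam Pfam) :
    CompactCountableFam (boxFamily Pfam) := by
  intro C hC
  have h1 := h _ (isCompact_union_s2 hC)
  refine ((countable_setOf_finite_subset h1).image
    (fun s => {A : VHyper X | A.carrier ⊆ ⋃₀ s ∧ ∀ P ∈ s, (A.carrier ∩ P).Nonempty})).mono ?_
  rintro B ⟨⟨Ps, -, hPs, rfl⟩, A, hAC, hA⟩
  refine ⟨Ps, ⟨Ps.finite_toSet, fun P hP => ⟨hPs hP, ?_⟩⟩, rfl⟩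
  exact (hA.2 P hP).mono (inter_subset_inter_left _
    (subset_biUnion_of_mem (u := fun A : VHyper X => A.carrier) hAC))

theorem boxFamily_kn [T2Space X] [RegularSpace X] {Pfam : Set (Set X)} (h : IsKNetwork Pfam) :
    IsKNetwork (boxFamily Pfam) := by
  classical
  intro C hC S hS hCS
  have hK := isCompact_union_s2 hC
  set K := ⋃ A ∈ C, A.carrier with hKdef
  suffices H : ∃ Q : Set (Set (VHyper X)), Q ⊆ boxFamily Pfam ∧ Q.Finite ∧ C ∩ C ⊆ ⋃₀ Q ∧ ⋃₀ Q ⊆ S by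
    simpa using H
  refine hC.induction_on (p := fun s => ∃ Q : Set (Set (VHyper X)),
    Q ⊆ boxFamily Pfam ∧ Q.Finite ∧ C ∩ s ⊆ ⋃₀ Q ∧ ⋃₀ Q ⊆ S) ⟨∅, by simp⟩ ?_ ?_ ?_
  · rintro s s' hss ⟨t, h1, h2, h3, h4⟩
    exact ⟨t, h1, h2, (inter_subset_inter_right _ hss).trans h3, h4⟩
  · rintro s s' ⟨t, h1, h2, h3, h4⟩ ⟨t', h1', h2', h3', h4'⟩
    refine ⟨t ∪ t', union_subset h1 h1', h2.union h2', ?_, ?_⟩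
    · rw [inter_union_distrib_left, sUnion_union]
      exact union_subset_union h3 h3'
    · rw [sUnion_union]
      exact union_subset h4 h4'
  · intro A hA
    obtain ⟨U, Ps, hU, hfin, hPo, hAU, hAP, hB⟩ := exists_basic hS A (hCS hA)
    have shr : ∀ (D : Set X) (V : Set X), IsCompact D → IsOpen V → D ⊆ V →
        ∃ (W : Set X) (Q : Set (Set X)), IsOpen W ∧ D ⊆ W ∧ Q ⊆ Pfam ∧ Q.Finite ∧
          K ∩ W ⊆ ⋃₀ Q ∧ ⋃₀ Q ⊆ V := by
      intro D V hD hV hDV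
      obtain ⟨W, hW, hDW, hWV⟩ := hD.exists_isOpen_closure_subset (hV.mem_nhdsSet.2 hDV)
      obtain ⟨Q, h1, h2, h3, h4⟩ := h (K ∩ closure W) (hK.inter_right isClosed_closure) V hV
        (inter_subset_right.trans hWV)
      exact ⟨W, Q, hW, hDW, h1, h2,
        (inter_subset_inter_right _ subset_closure).trans h3, h4⟩
    obtain ⟨O, Q0, hO, hAO, hQ0, hQ0f, hKQ0, hQ0U⟩ := shr A.carrier U A.isCompact' hU hAU
    have hch : ∀ P : Ps, ∃ (W : Set X) (Q : Set (Set X)), IsOpen W ∧ (A.carrier ∩ W).Nonempty ∧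
        Q ⊆ Pfam ∧ Q.Finite ∧ K ∩ W ⊆ ⋃₀ Q ∧ ⋃₀ Q ⊆ (P : Set X) ∩ U := by
      rintro ⟨P, hP⟩
      obtain ⟨a, haA, haP⟩ := hAP P hP
      obtain ⟨W, Q, h1, h2, h3⟩ := shr {a} (P ∩ U) isCompact_singleton ((hPo P hP).inter hU)
        (singleton_subset_iff.2 ⟨haP, hAU haA⟩)
      exact ⟨W, Q, h1, ⟨a, haA, h2 rfl⟩, h3⟩
    choose W Q hW hAW hQ hQf hKQ hQP using hch
    have := hfin.to_subtype
    let R : Set (Set X) := Q0 ∪ ⋃ P, Q P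
    have hR : R.Finite := hQ0f.union (finite_iUnion hQf)
    have hRP : R ⊆ Pfam := union_subset hQ0 (iUnion_subset hQ)
    have hRU : ∀ E ∈ R, E ⊆ U := by
      rintro E (hE | hE)
      · exact (subset_sUnion_of_mem hE).trans hQ0U
      · obtain ⟨P, hP⟩ := mem_iUnion.1 hE
        exact ((subset_sUnion_of_mem hP).trans (hQP P)).trans inter_subset_right
    refine ⟨{B | B.carrier ⊆ O} ∩ ⋂ P, {B | (B.carrier ∩ W P).Nonempty},
      mem_nhdsWithin_of_mem_nhds (IsOpen.mem_nhds ((isOpen_sub_s2 hO).inter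
        (isOpen_iInter_of_finite fun P => isOpen_meet (hW P))) ⟨hAO, mem_iInter.2 hAW⟩),
      {E | ∃ Ts : Finset (Set X), ((Ts : Set (Set X)) ⊆ R ∧ Ts.Nonempty ∧
        ∀ P : Ps, ∃ T ∈ Ts, T ∈ Q P) ∧ vbox Ts = E}, ?_, ?_, ?_, ?_⟩
    · rintro _ ⟨Ts, ⟨h1, h2, -⟩, rfl⟩
      exact ⟨Ts, h2, h1.trans hRP, rfl⟩
    · refine Set.Finite.image vbox (s := {Ts : Finset (Set X) | _}) ?_
      refine (hR.toFinset.powerset.finite_toSet).subset ?_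
      intro Ts hTs
      simp only [Finset.coe_powerset, mem_preimage, mem_powerset_iff, Finite.coe_toFinset]
      exact hTs.1
    · rintro B ⟨hBC, hBO, hBW⟩
      have hBK : B.carrier ⊆ K := subset_biUnion_of_mem (u := fun A : VHyper X => A.carrier) hBC
      let Ts : Finset (Set X) := hR.toFinset.filter fun T => (B.carrier ∩ T).Nonempty
      have hTs : ∀ T, T ∈ Ts ↔ T ∈ R ∧ (B.carrier ∩ T).Nonempty := by simp [Ts]
      have hcov : ∀ b ∈ B.carrier, ∃ T ∈ Ts, b ∈ T := by
        intro b hb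
        obtain ⟨T, hT, hbT⟩ := hKQ0 ⟨hBK hb, hBO hb⟩
        exact ⟨T, (hTs T).2 ⟨Or.inl hT, b, hb, hbT⟩, hbT⟩
      refine ⟨vbox Ts, ⟨Ts, ⟨fun T hT => ((hTs T).1 hT).1, ?_, ?_⟩, rfl⟩, ?_, ?_⟩
      · obtain ⟨b, hb⟩ := B.nonempty'
        obtain ⟨T, hT, -⟩ := hcov b hb
        exact ⟨T, hT⟩
      · intro P
        obtain ⟨b, hb, hbW⟩ := mem_iInter.1 hBW P
        obtain ⟨T, hT, hbT⟩ := hKQ P ⟨hBK hb, hbW⟩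
        exact ⟨T, (hTs T).2 ⟨Or.inr (mem_iUnion.2 ⟨P, hT⟩), b, hb, hbT⟩, hT⟩
      · intro b hb
        obtain ⟨T, hT, h⟩ := hcov b hb
        exact ⟨T, hT, h⟩
      · exact fun T hT => ((hTs T).1 hT).2
    · rintro B ⟨_, ⟨Ts, ⟨h1, -, h3⟩, rfl⟩, hB1, hB2⟩
      refine hB B (hB1.trans (sUnion_subset fun T hT => hRU T (h1 hT))) fun P hP => ?_
      obtain ⟨T, hT, hTQ⟩ := h3 ⟨P, hP⟩
      exact (hB2 T hT).mono (inter_subset_inter_right _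
        (((subset_sUnion_of_mem hTQ).trans (hQP ⟨P, hP⟩)).trans inter_subset_left))

/-- the singleton embedding -/
def sing (x : X) : VHyper X := ⟨{x}, isCompact_singleton, singleton_nonempty x⟩

theorem continuous_sing : Continuous (sing : X → VHyper X) := by
  refine continuous_generateFrom_iff.2 ?_
  rintro _ ⟨Ps, hPs, rfl⟩
  have : sing ⁻¹' vbox Ps = ⋃₀ (Ps : Set (Set X)) ∩ ⋂ P ∈ Ps, P := by
    ext x
    simp [vbox, sing]
  rw [this]
  exact (isOpen_sUnion hPs).inter (isOpen_biInter_finset hPs)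

theorem pre_cc {B : Set (Set (VHyper X))} (h : CompactCountableFam B) :
    CompactCountableFam ((fun s => sing ⁻¹' s) '' B) := by
  intro C hC
  refine ((h _ (hC.image continuous_sing)).image (fun s => sing ⁻¹' s)).mono ?_
  rintro _ ⟨⟨b, hb, rfl⟩, x, hx, hxb⟩
  exact ⟨b, ⟨hb, sing x, mem_image_of_mem _ hx, hxb⟩, rfl⟩

theorem pre_kn {B : Set (Set (VHyper X))} (h : IsKNetwork B) :
    IsKNetwork ((fun s => (sing ⁻¹' s : Set X)) '' B) := by
  intro C hC U hU hCU
  obtain ⟨Q, h1, h2, h3, h4⟩ := h _ (hC.image continuous_sing) _ (isOpen_sub_s2 hU) (by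
    rintro _ ⟨x, hx, rfl⟩
    exact singleton_subset_iff.2 (hCU hx))
  refine ⟨(fun s => sing ⁻¹' s) '' Q, image_mono h1, h2.image _, ?_, ?_⟩
  · intro x hx
    obtain ⟨q, hq, hxq⟩ := h3 (mem_image_of_mem _ hx)
    exact ⟨_, mem_image_of_mem _ hq, hxq⟩
  · rintro x ⟨_, ⟨q, hq, rfl⟩, hxq⟩
    exact singleton_subset_iff.1 (h4 ⟨q, hq, hxq⟩)

end VHyper

/-- `X` has a compact-countable (resp. compact-countable closed) k-network iff `𝒦(X)`
does. -/
theorem statement2 {X : Type*} [TopologicalSpace X] [T2Space X] [RegularSpace X] :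
    ((∃ Pfam : Set (Set X), CompactCountableFam Pfam ∧ IsKNetwork Pfam) ↔
      (∃ Bfam : Set (Set (VHyper X)), CompactCountableFam Bfam ∧ IsKNetwork Bfam)) ∧
    ((∃ Pfam : Set (Set X), CompactCountableFam Pfam ∧ (∀ P ∈ Pfam, IsClosed P) ∧
        IsKNetwork Pfam) ↔
      (∃ Bfam : Set (Set (VHyper X)), CompactCountableFam Bfam ∧ (∀ B ∈ Bfam, IsClosed B) ∧
        IsKNetwork Bfam)) := by
  refine ⟨⟨?_, ?_⟩, ?_, ?_⟩
  · rintro ⟨P, h1, h2⟩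
    exact ⟨_, VHyper.boxFamily_cc h1, VHyper.boxFamily_kn h2⟩
  · rintro ⟨P, h1, h2⟩
    exact ⟨_, VHyper.pre_cc h1, VHyper.pre_kn h2⟩
  · rintro ⟨P, h1, hc, h2⟩
    refine ⟨_, VHyper.boxFamily_cc h1, ?_, VHyper.boxFamily_kn h2⟩
    rintro _ ⟨Ps, -, h, rfl⟩
    exact VHyper.isClosed_vbox Ps fun P hP => hc P (h hP)
  · rintro ⟨P, h1, hc, h2⟩
    refine ⟨_, VHyper.pre_cc h1, ?_, VHyper.pre_kn h2⟩
    rintro _ ⟨b, hb, rfl⟩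
    exact (hc b hb).preimage VHyper.continuous_sing
end

section
/- A regular T2 space X is an ℵ-space if and only if the hyperspace 𝒦(X) with the Vietoris topology is an ℵ-space. -/
open TopologicalSpace Set

namespace VHyper

lemma isOpen_upper {X : Type*} [TopologicalSpace X] {W : Set X} (hW : IsOpen W) :
    IsOpen {A : VHyper X | A.carrier ⊆ W} := by
  classical
  apply TopologicalSpace.isOpen_generateFrom_of_mem
  refine ⟨{W}, by simpa using hW, ?_⟩
  ext A
  simp only [vbox, Set.mem_setOf_eq, Finset.coe_singleton, Set.sUnion_singleton,
    Finset.mem_singleton, forall_eq]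
  refine ⟨fun h => ⟨h, ?_⟩, fun h => h.1⟩
  obtain ⟨x, hx⟩ := A.nonempty'
  exact ⟨x, hx, h hx⟩

lemma isOpen_lower {X : Type*} [TopologicalSpace X] {W : Set X} (hW : IsOpen W) :
    IsOpen {A : VHyper X | (A.carrier ∩ W).Nonempty} := by
  classical
  apply TopologicalSpace.isOpen_generateFrom_of_mem
  refine ⟨{Set.univ, W}, by simpa using hW, ?_⟩
  ext A
  simp only [vbox, Set.mem_setOf_eq, Finset.coe_insert, Finset.coe_singleton, Set.sUnion_insert,
    Set.univ_union, Set.subset_univ, true_and, Finset.mem_insert,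
    Finset.mem_singleton, forall_eq_or_imp, forall_eq, Set.inter_univ]
  exact ⟨fun h => ⟨A.nonempty', h⟩, fun h => h.2⟩

lemma exists_basic_s3 {X : Type*} [TopologicalSpace X] {G : Set (VHyper X)} (hG : IsOpen G) :
    ∀ K ∈ G, ∃ W : Set X, IsOpen W ∧ K.carrier ⊆ W ∧ ∃ H : Set (Set X), H.Finite ∧
      (∀ h ∈ H, IsOpen h ∧ (K.carrier ∩ h).Nonempty) ∧
      ∀ A : VHyper X, A.carrier ⊆ W → (∀ h ∈ H, (A.carrier ∩ h).Nonempty) → A ∈ G := by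
  induction hG with
  | basic s hs =>
    obtain ⟨Ps, hP, rfl⟩ := hs
    intro K hK
    exact ⟨⋃₀ (Ps : Set (Set X)), isOpen_sUnion (fun t ht => hP t (by simpa using ht)), hK.1,
      (Ps : Set (Set X)), Ps.finite_toSet,
      fun h hh => ⟨hP h (by simpa using hh), hK.2 h (by simpa using hh)⟩,
      fun A h1 h2 => ⟨h1, fun P hP => h2 P (by simpa using hP)⟩⟩
  | univ =>
    intro K _
    exact ⟨Set.univ, isOpen_univ, Set.subset_univ _, ∅, Set.finite_empty, by simp, by simp⟩
  | inter s t _ _ ihs iht =>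
    intro K hK
    obtain ⟨W, hW, hKW, H, hH, hH1, hH2⟩ := ihs K hK.1
    obtain ⟨W', hW', hKW', H', hH', hH1', hH2'⟩ := iht K hK.2
    refine ⟨W ∩ W', hW.inter hW', Set.subset_inter hKW hKW', H ∪ H', hH.union hH', ?_, ?_⟩
    · rintro h (h1 | h1)
      exacts [hH1 h h1, hH1' h h1]
    · intro A h1 h2
      exact ⟨hH2 A (h1.trans Set.inter_subset_left) fun h hh => h2 h (Or.inl hh),
        hH2' A (h1.trans Set.inter_subset_right) fun h hh => h2 h (Or.inr hh)⟩
  | sUnion S _ ih =>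
    rintro K ⟨s, hs, hK⟩
    obtain ⟨W, hW, hKW, H, hH, hH1, hH2⟩ := ih s hs K hK
    exact ⟨W, hW, hKW, H, hH, hH1, fun A h1 h2 => ⟨s, hs, hH2 A h1 h2⟩⟩

lemma isCompact_iUnion {X : Type*} [TopologicalSpace X] {C : Set (VHyper X)} (hC : IsCompact C) :
    IsCompact (⋃ A ∈ C, A.carrier) := by
  apply isCompact_of_finite_subcover
  intro ι U hU hCU
  have key : ∃ t : Finset ι, ∀ A ∈ C, A.carrier ⊆ ⋃ i ∈ t, U i := by
    refine hC.induction_on (p := fun S => ∃ t : Finset ι, ∀ A ∈ S, A.carrier ⊆ ⋃ i ∈ t, U i)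
      ⟨∅, by simp⟩ ?_ ?_ ?_
    · rintro s t hst ⟨u, hu⟩
      exact ⟨u, fun A hA => hu A (hst hA)⟩
    · classical
      rintro s t ⟨u, hu⟩ ⟨v, hv⟩
      refine ⟨u ∪ v, ?_⟩
      rintro A (hA | hA)
      · exact (hu A hA).trans (Set.biUnion_mono (fun i hi => by
          simp at hi ⊢; exact Or.inl hi) fun _ _ => subset_rfl)
      · exact (hv A hA).trans (Set.biUnion_mono (fun i hi => by
          simp at hi ⊢; exact Or.inr hi) fun _ _ => subset_rfl)
    · intro K hK
      obtain ⟨t, ht⟩ := K.isCompact'.elim_finite_subcover U hU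
        ((Set.subset_biUnion_of_mem (u := fun A : VHyper X => A.carrier) hK).trans hCU)
      exact ⟨_, mem_nhdsWithin_of_mem_nhds ((isOpen_upper
        (isOpen_biUnion fun i (_ : i ∈ t) => hU i)).mem_nhds ht), t, fun A hA => hA⟩
  obtain ⟨t, ht⟩ := key
  exact ⟨t, Set.iUnion₂_subset ht⟩

end VHyper

lemma locallyFiniteFam_compact {X : Type*} [TopologicalSpace X] {P : Set (Set X)}
    (hP : LocallyFiniteFam P) {K : Set X} (hK : IsCompact K) :
    ∃ O, IsOpen O ∧ K ⊆ O ∧ {Q ∈ P | (O ∩ Q).Nonempty}.Finite := by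
  refine hK.induction_on
    (p := fun S => ∃ O, IsOpen O ∧ S ⊆ O ∧ {Q ∈ P | (O ∩ Q).Nonempty}.Finite) ?_ ?_ ?_ ?_
  · exact ⟨∅, isOpen_empty, subset_rfl, by simp⟩
  · rintro s t hst ⟨O, h1, h2, h3⟩
    exact ⟨O, h1, hst.trans h2, h3⟩
  · rintro s t ⟨O, h1, h2, h3⟩ ⟨O', h1', h2', h3'⟩
    refine ⟨O ∪ O', h1.union h1', Set.union_subset_union h2 h2', (h3.union h3').subset ?_⟩
    rintro Q ⟨hQ, x, hx | hx, hxQ⟩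
    · exact Or.inl ⟨hQ, x, hx, hxQ⟩
    · exact Or.inr ⟨hQ, x, hx, hxQ⟩
  · intro x _
    obtain ⟨O, hO, hf⟩ := hP x
    refine ⟨interior O, mem_nhdsWithin_of_mem_nhds (interior_mem_nhds.2 hO), interior O,
      isOpen_interior, subset_rfl, hf.subset ?_⟩
    rintro Q ⟨hQ, y, hy, hyQ⟩
    exact ⟨hQ, y, interior_subset hy, hyQ⟩

lemma locallyFiniteFam_le {X : Type*} [TopologicalSpace X] {P : ℕ → Set (Set X)}
    (hP : ∀ n, LocallyFiniteFam (P n)) (n : ℕ) :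
    LocallyFiniteFam {Q | ∃ m ≤ n, Q ∈ P m} := by
  intro y
  choose O hO hf using fun m => hP m y
  refine ⟨⋂ m ∈ Set.Iic n, O m, (Filter.biInter_mem (Set.finite_Iic n)).2 fun m _ => hO m,
    ((Set.finite_Iic n).biUnion fun m _ => hf m).subset ?_⟩
  rintro Q ⟨⟨m, hm, hQ⟩, x, hx, hxQ⟩
  exact Set.mem_biUnion (show m ∈ Set.Iic n from hm) ⟨hQ, x, Set.mem_iInter₂.1 hx m hm, hxQ⟩

lemma aleph_of_hyper {X : Type*} [TopologicalSpace X]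
    (h : IsAlephSpace (VHyper X)) : IsAlephSpace X := by
  obtain ⟨P, hP, hk⟩ := h
  let f : X → VHyper X := fun x => ⟨{x}, isCompact_singleton, Set.singleton_nonempty x⟩
  have hf : Continuous f := by
    refine continuous_def.2 fun G hG => isOpen_iff_mem_nhds.2 fun x hx => ?_
    obtain ⟨W, hW, hKW, H, hH, hH1, hH2⟩ := VHyper.exists_basic_s3 hG (f x) hx
    have h1 : W ∩ ⋂ h ∈ H, h ∈ nhds x := by
      refine Filter.inter_mem (hW.mem_nhds (hKW rfl)) ((Filter.biInter_mem hH).2 fun h hh => ?_)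
      obtain ⟨ho, y, hy, hyh⟩ := hH1 h hh
      have : y = x := hy
      exact ho.mem_nhds (this ▸ hyh)
    refine Filter.mem_of_superset h1 ?_
    rintro y ⟨hy, hy'⟩
    exact hH2 (f y) (Set.singleton_subset_iff.2 hy)
      fun h hh => ⟨y, rfl, Set.mem_iInter₂.1 hy' h hh⟩
  refine ⟨fun n => (fun B => f ⁻¹' B) '' P n, fun n y => ?_, ?_⟩
  · obtain ⟨O, hO, hfin⟩ := hP n (f y)
    refine ⟨f ⁻¹' O, hf.continuousAt hO, (hfin.image fun B => f ⁻¹' B).subset ?_⟩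
    rintro _ ⟨⟨B, hB, rfl⟩, x, hx, hxB⟩
    exact ⟨B, ⟨hB, f x, hx, hxB⟩, rfl⟩
  · intro C hC U hU hCU
    obtain ⟨Q, hQ, hQf, hCQ, hQU⟩ := hk (f '' C) (hC.image hf) _ (VHyper.isOpen_upper hU) (by
      rintro _ ⟨x, hx, rfl⟩
      exact Set.singleton_subset_iff.2 (hCU hx))
    refine ⟨(fun B => f ⁻¹' B) '' Q, ?_, hQf.image _, ?_, ?_⟩
    · rintro _ ⟨B, hB, rfl⟩
      obtain ⟨n, hn⟩ := Set.mem_iUnion.1 (hQ hB)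
      exact Set.mem_iUnion.2 ⟨n, B, hn, rfl⟩
    · intro x hx
      obtain ⟨B, hB, hxB⟩ := hCQ ⟨x, hx, rfl⟩
      exact ⟨_, ⟨B, hB, rfl⟩, hxB⟩
    · rintro x ⟨_, ⟨B, hB, rfl⟩, hx⟩
      exact hQU ⟨B, hB, hx⟩ rfl

lemma hyper_of_aleph {X : Type*} [TopologicalSpace X] [RegularSpace X]
    (h : IsAlephSpace X) : IsAlephSpace (VHyper X) := by
  classical
  obtain ⟨P, hP, hk⟩ := h
  refine ⟨fun n => {B | ∃ Ps : Finset (Set X), (∀ Q ∈ Ps, ∃ m ≤ n, Q ∈ P m) ∧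
    B = VHyper.vbox Ps}, fun n K => ?_, ?_⟩
  · obtain ⟨O, hO, hKO, hfin⟩ := locallyFiniteFam_compact (locallyFiniteFam_le hP n) K.isCompact'
    refine ⟨_, (VHyper.isOpen_upper hO).mem_nhds hKO,
      (hfin.toFinset.powerset.finite_toSet.image VHyper.vbox).subset ?_⟩
    rintro _ ⟨⟨Ps, hPs, rfl⟩, A, hAO, hA⟩
    refine ⟨Ps, ?_, rfl⟩
    simp only [Finset.mem_coe, Finset.mem_powerset]
    intro Q hQ
    obtain ⟨x, hx, hxQ⟩ := hA.2 Q hQ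
    simp only [Set.Finite.mem_toFinset]
    exact ⟨hPs Q hQ, x, hAO hx, hxQ⟩
  · intro C hC U hU hCU
    have hD := VHyper.isCompact_iUnion hC
    set D := ⋃ A ∈ C, A.carrier with hDdef
    set B := ⋃ n, {B | ∃ Ps : Finset (Set X), (∀ Q ∈ Ps, ∃ m ≤ n, Q ∈ P m) ∧
      B = VHyper.vbox Ps} with hB
    have hBmem : ∀ Ps : Finset (Set X), (∀ Q ∈ Ps, Q ∈ ⋃ n, P n) → VHyper.vbox Ps ∈ B := by
      intro Ps hPs
      have : ∀ Q : Set X, ∃ m, Q ∈ Ps → Q ∈ P m := by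
        intro Q
        by_cases hQ : Q ∈ Ps
        · obtain ⟨m, hm⟩ := Set.mem_iUnion.1 (hPs Q hQ)
          exact ⟨m, fun _ => hm⟩
        · exact ⟨0, fun h => absurd h hQ⟩
      choose g hg using this
      exact Set.mem_iUnion.2 ⟨Ps.sup g, Ps, fun Q hQ => ⟨g Q, Finset.le_sup hQ, hg Q hQ⟩, rfl⟩
    have key : ∃ Q : Set (Set (VHyper X)), Q ⊆ B ∧ Q.Finite ∧ C ∩ C ⊆ ⋃₀ Q ∧ ⋃₀ Q ⊆ U := by
      refine hC.induction_on (p := fun S => ∃ Q : Set (Set (VHyper X)), Q ⊆ B ∧ Q.Finite ∧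
        S ∩ C ⊆ ⋃₀ Q ∧ ⋃₀ Q ⊆ U) ⟨∅, by simp⟩ ?_ ?_ ?_
      · rintro s t hst ⟨Q, h1, h2, h3, h4⟩
        exact ⟨Q, h1, h2, (Set.inter_subset_inter_left _ hst).trans h3, h4⟩
      · rintro s t ⟨Q, h1, h2, h3, h4⟩ ⟨Q', h1', h2', h3', h4'⟩
        refine ⟨Q ∪ Q', Set.union_subset h1 h1', h2.union h2', ?_, ?_⟩
        · rw [Set.sUnion_union, Set.union_inter_distrib_right]
          exact Set.union_subset_union h3 h3'
        · rw [Set.sUnion_union]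
          exact Set.union_subset h4 h4'
      · intro K hK
        obtain ⟨W, hW, hKW, H, hH, hH1, hH2⟩ := VHyper.exists_basic_s3 hU K (hCU hK)
        obtain ⟨W', hW', hKW', hcW'⟩ : ∃ W', IsOpen W' ∧ K.carrier ⊆ W' ∧ closure W' ⊆ W := by
          obtain ⟨V, h1, h2, h3⟩ := K.isCompact'.exists_isOpen_closure_subset (hW.mem_nhdsSet.2 hKW)
          exact ⟨V, h1, h2, h3⟩
        have : ∀ h : Set X, ∃ h' : Set X, h ∈ H → IsOpen h' ∧ (K.carrier ∩ h').Nonempty ∧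
            closure h' ⊆ h := by
          intro h
          by_cases hh : h ∈ H
          · obtain ⟨ho, x, hx, hxh⟩ := hH1 h hh
            obtain ⟨V, h1, h2, h3⟩ := (isCompact_singleton (x := x)).exists_isOpen_closure_subset
              (ho.mem_nhdsSet.2 (Set.singleton_subset_iff.2 hxh))
            exact ⟨V, fun _ => ⟨h1, ⟨x, hx, h2 rfl⟩, h3⟩⟩
          · exact ⟨∅, fun h => absurd h hh⟩
        choose g hg using this
        obtain ⟨Q0, hQ0, hQ0f, hDQ0, hQ0W⟩ := hk (D ∩ closure W')
          (hD.inter_right isClosed_closure) W hW (Set.inter_subset_right.trans hcW')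
        have : ∀ h : Set X, ∃ R : Set (Set X), h ∈ H → R ⊆ (⋃ n, P n) ∧ R.Finite ∧
            (D ∩ closure W') ∩ closure (g h) ⊆ ⋃₀ R ∧ ⋃₀ R ⊆ W ∩ h := by
          intro h
          by_cases hh : h ∈ H
          · obtain ⟨R, hR⟩ := hk ((D ∩ closure W') ∩ closure (g h))
              ((hD.inter_right isClosed_closure).inter_right isClosed_closure) (W ∩ h)
              (hW.inter (hH1 h hh).1)
              (Set.inter_subset_inter (Set.inter_subset_right.trans hcW') (hg h hh).2.2)
            exact ⟨R, fun _ => hR⟩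
          · exact ⟨∅, fun h => absurd h hh⟩
        choose R hR using this
        have hTf : (Q0 ∪ ⋃ h ∈ H, R h).Finite :=
          hQ0f.union (hH.biUnion fun h hh => (hR h hh).2.1)
        have hTP : (Q0 ∪ ⋃ h ∈ H, R h) ⊆ ⋃ n, P n :=
          Set.union_subset hQ0 (Set.iUnion₂_subset fun h hh => (hR h hh).1)
        have hTW : ∀ q ∈ (Q0 ∪ ⋃ h ∈ H, R h), q ⊆ W := by
          rintro q (hq | hq)
          · exact (Set.subset_sUnion_of_mem hq).trans hQ0W
          · obtain ⟨h, hh, hq⟩ := Set.mem_iUnion₂.1 hq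
            exact ((Set.subset_sUnion_of_mem hq).trans (hR h hh).2.2.2).trans
              Set.inter_subset_left
        set T := hTf.toFinset with hT
        have hTm : ∀ q, q ∈ T ↔ q ∈ (Q0 ∪ ⋃ h ∈ H, R h) := fun q => hTf.mem_toFinset
        let good : Set (Finset (Set X)) := {Ps | Ps ⊆ T ∧ ∀ h ∈ H, ∃ q ∈ Ps, q ⊆ h}
        have hgf : good.Finite := T.powerset.finite_toSet.subset fun Ps hPs => by
          simpa using hPs.1
        refine ⟨{A | A.carrier ⊆ W'} ∩ ⋂ h ∈ H, {A | (A.carrier ∩ g h).Nonempty},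
          mem_nhdsWithin_of_mem_nhds (Filter.inter_mem ((VHyper.isOpen_upper hW').mem_nhds hKW')
            ((Filter.biInter_mem hH).2 fun h hh =>
              (VHyper.isOpen_lower (hg h hh).1).mem_nhds (hg h hh).2.1)),
          VHyper.vbox '' good, ?_, hgf.image _, ?_, ?_⟩
        · rintro _ ⟨Ps, hPs, rfl⟩
          exact hBmem Ps fun Q hQ => hTP ((hTm Q).1 (hPs.1 hQ))
        · rintro A ⟨⟨hAW, hAh⟩, hAC⟩
          have hAD : A.carrier ⊆ D :=
            Set.subset_biUnion_of_mem (u := fun A : VHyper X => A.carrier) hAC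
          refine ⟨_, ⟨T.filter fun q => (A.carrier ∩ q).Nonempty,
            ⟨Finset.filter_subset _ _, ?_⟩, rfl⟩, ?_, ?_⟩
          · intro h hh
            obtain ⟨x, hx, hxg⟩ := Set.mem_iInter₂.1 hAh h hh
            obtain ⟨q, hq, hxq⟩ := (hR h hh).2.2.1
              ⟨⟨hAD hx, subset_closure (hAW hx)⟩, subset_closure hxg⟩
            refine ⟨q, Finset.mem_filter.2 ⟨(hTm q).2 (Or.inr (Set.mem_biUnion hh hq)),
              x, hx, hxq⟩, ?_⟩
            exact ((Set.subset_sUnion_of_mem hq).trans (hR h hh).2.2.2).trans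
              Set.inter_subset_right
          · intro x hx
            obtain ⟨q, hq, hxq⟩ := hDQ0 ⟨hAD hx, subset_closure (hAW hx)⟩
            exact ⟨q, Finset.mem_coe.2
              (Finset.mem_filter.2 ⟨(hTm q).2 (Or.inl hq), x, hx, hxq⟩), hxq⟩
          · intro q hq
            exact (Finset.mem_filter.1 hq).2
        · rintro A ⟨_, ⟨Ps, ⟨hPT, hPh⟩, rfl⟩, hA1, hA2⟩
          refine hH2 A (hA1.trans (Set.sUnion_subset fun q hq =>
            hTW q ((hTm q).1 (hPT (Finset.mem_coe.1 hq))))) fun h hh => ?_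
          obtain ⟨q, hq, hqh⟩ := hPh h hh
          exact (hA2 q hq).mono (Set.inter_subset_inter_right _ hqh)
    simpa only [Set.inter_self] using key

/-- `X` is an ℵ-space iff `𝒦(X)` is an ℵ-space. -/
theorem statement3 {X : Type*} [TopologicalSpace X] [T2Space X] [RegularSpace X] :
    IsAlephSpace X ↔ IsAlephSpace (VHyper X) := by
  exact ⟨hyper_of_aleph, aleph_of_hyper⟩
end

section
/- For a regular T2 space X the following are equivalent: (1) X is an ℵ-space; (2) ℱ₂(X) has a σ-hereditarily closure-preserving k-network; (3) ℱ(X) has a σ-hereditarily closure-preserving k-network; (4) ℱ(X) is an ℵ-space; (5) 𝒦(X) is an ℵ-space. -/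
open TopologicalSpace Set

section Helpers

open Topology Filter

universe u v

/-! General lemmas -/

theorem aux_union_mono {Y : Type u} {P : ℕ → Set (Set Y)} (hm : Monotone P)
    {Q : Set (Set Y)} (hQ : Q.Finite) (hs : Q ⊆ ⋃ n, P n) : ∃ n, Q ⊆ P n := by
  induction Q, hQ using Set.Finite.induction_on with
  | empty => exact ⟨0, empty_subset _⟩
  | @insert a s _ _ ih =>
    obtain ⟨n, hn⟩ := ih (fun x hx => hs (mem_insert_of_mem _ hx))
    obtain ⟨m, hmm⟩ := mem_iUnion.1 (hs (mem_insert a s))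
    refine ⟨max n m, ?_⟩
    rintro x (rfl | hx)
    · exact hm (le_max_right _ _) hmm
    · exact hm (le_max_left _ _) (hn hx)

theorem aux_accumulate {Y : Type u} (P : ℕ → Set (Set Y)) :
    ⋃ n, Set.accumulate P n = ⋃ n, P n := Set.iUnion_accumulate

theorem LocallyFiniteFam.union' {Y : Type u} [TopologicalSpace Y] {A B : Set (Set Y)}
    (hA : LocallyFiniteFam A) (hB : LocallyFiniteFam B) : LocallyFiniteFam (A ∪ B) := by
  intro y
  obtain ⟨O, hO, hf⟩ := hA y
  obtain ⟨O', hO', hf'⟩ := hB y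
  refine ⟨O ∩ O', inter_mem hO hO', (hf.union hf').subset ?_⟩
  rintro P ⟨hP | hP, z, ⟨hz, hz'⟩, hzP⟩
  · exact Or.inl ⟨hP, z, hz, hzP⟩
  · exact Or.inr ⟨hP, z, hz', hzP⟩

theorem IsHCP.union' {Y : Type u} [TopologicalSpace Y] {A B : Set (Set Y)}
    (hA : IsHCP A) (hB : IsHCP B) : IsHCP (A ∪ B) := by
  intro S hS Q hQ
  have e : Q = (Q ∩ A) ∪ (Q ∩ B) := by
    rw [← inter_union_distrib_left]; exact (inter_eq_left.2 hQ).symm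
  rw [e, biUnion_union, biUnion_union, closure_union,
    hA S (fun P hP => hS P (Or.inl hP)) _ inter_subset_right,
    hB S (fun P hP => hS P (Or.inr hP)) _ inter_subset_right]

theorem aux_acc_succ {Y : Type u} (P : ℕ → Set (Set Y)) (n : ℕ) :
    Set.accumulate P (n + 1) = Set.accumulate P n ∪ P (n + 1) := Set.accumulate_succ P n

theorem aux_acc_ind {Y : Type u} {P : ℕ → Set (Set Y)} (q : Set (Set Y) → Prop)
    (h : ∀ n, q (P n)) (hu : ∀ A B, q A → q B → q (A ∪ B)) (n : ℕ) : q (Set.accumulate P n) := by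
  induction n with
  | zero =>
    have : Set.accumulate P 0 = P 0 := by ext x; simp [Set.accumulate_def]
    rw [this]; exact h 0
  | succ n ih => rw [aux_acc_succ]; exact hu _ _ ih (h _)

theorem aux_aleph_mono {Y : Type u} [TopologicalSpace Y] (h : IsAlephSpace Y) :
    ∃ P : ℕ → Set (Set Y), Monotone P ∧ (∀ n, LocallyFiniteFam (P n)) ∧
      IsKNetwork (⋃ n, P n) := by
  obtain ⟨P, h1, h2⟩ := h
  exact ⟨Set.accumulate P, Set.monotone_accumulate,
    aux_acc_ind _ h1 (fun _ _ => LocallyFiniteFam.union'), by rwa [Set.iUnion_accumulate]⟩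

theorem aux_hcp_mono {Y : Type u} [TopologicalSpace Y] (h : HasSigmaHCPKNetwork Y) :
    ∃ P : ℕ → Set (Set Y), Monotone P ∧ (∀ n, IsHCP (P n)) ∧
      IsKNetwork (⋃ n, P n) := by
  obtain ⟨P, h1, h2⟩ := h
  exact ⟨Set.accumulate P, Set.monotone_accumulate,
    aux_acc_ind _ h1 (fun _ _ => IsHCP.union'), by rwa [Set.iUnion_accumulate]⟩

theorem aux_aleph_countable {Y : Type u} [TopologicalSpace Y] {ι : Type} [Countable ι] [Nonempty ι]
    (P : ι → Set (Set Y)) (h : ∀ i, LocallyFiniteFam (P i)) (hk : IsKNetwork (⋃ i, P i)) :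
    IsAlephSpace Y := by
  obtain ⟨f, hf⟩ := exists_surjective_nat ι
  refine ⟨fun n => P (f n), fun n => h _, ?_⟩
  rwa [hf.iUnion_comp P]

theorem aux_knet_inducing {Y : Type u} {Z : Type v} [TopologicalSpace Y] [TopologicalSpace Z]
    {f : Y → Z} (hf : IsInducing f) {P : ℕ → Set (Set Z)} (hk : IsKNetwork (⋃ n, P n)) :
    IsKNetwork (⋃ n, (fun A => f ⁻¹' A) '' (P n)) := by
  intro C hC U hU hCU
  obtain ⟨V, hV, rfl⟩ := hf.isOpen_iff.1 hU
  obtain ⟨Q, hQ, hQf, hc, hu⟩ := hk (f '' C) (hC.image hf.continuous) V hV (image_subset_iff.2 hCU)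
  refine ⟨(fun A => f ⁻¹' A) '' Q, ?_, hQf.image _, ?_, ?_⟩
  · rw [← image_iUnion]; exact image_mono hQ
  · intro c hc'
    obtain ⟨A, hA, hcA⟩ := hc (mem_image_of_mem f hc')
    exact ⟨_, mem_image_of_mem _ hA, hcA⟩
  · rintro c ⟨_, ⟨A, hA, rfl⟩, hcA⟩
    exact hu ⟨A, hA, hcA⟩

theorem aux_aleph_inducing {Y : Type u} {Z : Type v} [TopologicalSpace Y] [TopologicalSpace Z]
    {f : Y → Z} (hf : IsInducing f) (h : IsAlephSpace Z) : IsAlephSpace Y := by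
  obtain ⟨P, h1, h2⟩ := h
  refine ⟨_, fun n => ?_, aux_knet_inducing hf h2⟩
  intro y
  obtain ⟨O, hO, hfin⟩ := h1 n (f y)
  refine ⟨f ⁻¹' O, hf.continuous.continuousAt hO, (hfin.image (fun A => f ⁻¹' A)).subset ?_⟩
  rintro _ ⟨⟨A, hA, rfl⟩, z, hz, hzA⟩
  exact ⟨A, ⟨hA, f z, hz, hzA⟩, rfl⟩

theorem aux_hcp_preimage {Y : Type u} {Z : Type v} [TopologicalSpace Y] [TopologicalSpace Z]
    {f : Y → Z} (hf : IsInducing f) {P : Set (Set Z)} (h : IsHCP P) :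
    IsHCP ((fun A => f ⁻¹' A) '' P) := by
  intro S hS Q hQ
  have key := h (fun A => f '' (S (f ⁻¹' A)))
    (fun A hA => image_subset_iff.2 (hS _ (mem_image_of_mem _ hA)))
    {A ∈ P | f ⁻¹' A ∈ Q} (sep_subset _ _)
  have e : (⋃ A ∈ {A ∈ P | f ⁻¹' A ∈ Q}, f '' (S (f ⁻¹' A))) = f '' (⋃ B ∈ Q, S B) := by
    ext z
    simp only [mem_iUnion, mem_image, mem_ofPred_eq, exists_prop]
    constructor
    · rintro ⟨A, ⟨hA, hAQ⟩, y, hy, rfl⟩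
      exact ⟨y, ⟨_, hAQ, hy⟩, rfl⟩
    · rintro ⟨y, ⟨B, hB, hy⟩, rfl⟩
      obtain ⟨A, hA, rfl⟩ := hQ hB
      exact ⟨A, ⟨hA, hB⟩, y, hy, rfl⟩
  rw [e] at key
  apply subset_antisymm
  · intro y hy
    rw [hf.closure_eq_preimage_closure_image, key] at hy
    simp only [mem_preimage, mem_iUnion, mem_ofPred_eq, exists_prop] at hy ⊢
    obtain ⟨A, ⟨hA, hAQ⟩, hy⟩ := hy
    refine ⟨_, hAQ, ?_⟩
    rwa [hf.closure_eq_preimage_closure_image]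
  · exact iUnion₂_subset fun B hB => closure_mono (subset_biUnion_of_mem (u := S) hB)

theorem aux_hasHCP_inducing {Y : Type u} {Z : Type v} [TopologicalSpace Y] [TopologicalSpace Z]
    {f : Y → Z} (hf : IsInducing f) (h : HasSigmaHCPKNetwork Z) : HasSigmaHCPKNetwork Y := by
  obtain ⟨P, h1, h2⟩ := h
  exact ⟨_, fun n => aux_hcp_preimage hf (h1 n), aux_knet_inducing hf h2⟩

theorem aux_lf_hcp {Y : Type u} [TopologicalSpace Y] {P : Set (Set Y)} (h : LocallyFiniteFam P) :
    IsHCP P := by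
  intro S hS Q hQ
  have : LocallyFinite (fun A : Q => S A) := by
    intro y
    obtain ⟨O, hO, hfin⟩ := h y
    refine ⟨O, hO, Set.Finite.of_finite_image (f := Subtype.val) (hfin.subset ?_)
      Subtype.val_injective.injOn⟩
    rintro _ ⟨A, ⟨z, hz, hzO⟩, rfl⟩
    exact ⟨hQ A.2, z, hzO, hS _ (hQ A.2) hz⟩
  rw [biUnion_eq_iUnion, biUnion_eq_iUnion]
  exact this.closure_iUnion

/-- closed closure-preserving increasing k-network -/
theorem aux_cpk {Y : Type u} [TopologicalSpace Y] [RegularSpace Y] (h : HasSigmaHCPKNetwork Y) :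
    ∃ G : ℕ → Set (Set Y), Monotone G ∧ (∀ n, ∀ Q ⊆ G n, IsClosed (⋃₀ Q)) ∧
      IsKNetwork (⋃ n, G n) := by
  obtain ⟨P, hm, h1, h2⟩ := aux_hcp_mono h
  refine ⟨fun n => closure '' (P n), fun a b hab => image_mono (hm hab), ?_, ?_⟩
  · intro n Q hQ
    have := h1 n id (fun A _ => subset_rfl) {A ∈ P n | closure A ∈ Q} (sep_subset _ _)
    have e : ⋃₀ Q = ⋃ A ∈ {A ∈ P n | closure A ∈ Q}, closure (id A) := by
      ext z
      simp only [mem_sUnion, mem_iUnion, mem_ofPred_eq, exists_prop, id]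
      constructor
      · rintro ⟨B, hB, hz⟩
        obtain ⟨A, hA, rfl⟩ := hQ hB
        exact ⟨A, ⟨hA, hB⟩, hz⟩
      · rintro ⟨A, ⟨hA, hB⟩, hz⟩
        exact ⟨_, hB, hz⟩
    rw [e, ← this]; exact isClosed_closure
  · intro C hC U hU hCU
    obtain ⟨V, hV, hCV, hVU⟩ := hC.exists_isOpen_closure_subset (hU.mem_nhdsSet.2 hCU)
    obtain ⟨Q, hQ, hQf, hc, hu⟩ := h2 C hC V hV hCV
    refine ⟨closure '' Q, ?_, hQf.image _, ?_, ?_⟩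
    · rw [← image_iUnion]; exact image_mono hQ
    · intro c hc'
      obtain ⟨A, hA, hcA⟩ := hc hc'
      exact ⟨_, mem_image_of_mem _ hA, subset_closure hcA⟩
    · rintro c ⟨_, ⟨A, hA, rfl⟩, hcA⟩
      exact hVU (closure_mono (fun a ha => hu ⟨A, hA, ha⟩) hcA)

/-- the "all compact sets are finite" case (Siwiec--Nagata) -/
theorem aux_case2 {Y : Type u} [TopologicalSpace Y] [RegularSpace Y] (h : HasSigmaHCPKNetwork Y)
    (hfin : ∀ C : Set Y, IsCompact C → C.Finite) : IsAlephSpace Y := by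
  obtain ⟨G, hm, hcl, hk⟩ := aux_cpk h
  have hnet : ∀ y : Y, ∀ U, IsOpen U → y ∈ U → ∃ n, ∃ A ∈ G n, y ∈ A ∧ A ⊆ U := by
    intro y U hU hy
    obtain ⟨Q, hQ, -, hc, hu⟩ := hk {y} isCompact_singleton U hU (singleton_subset_iff.2 hy)
    obtain ⟨A, hA, hyA⟩ := hc rfl
    obtain ⟨n, hn⟩ := mem_iUnion.1 (hQ hA)
    exact ⟨n, A, hn, hyA, fun a ha => hu ⟨A, hA, ha⟩⟩
  let O : ℕ → Y → Set Y := fun n y => (⋃₀ {A ∈ G n | y ∉ A})ᶜ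
  have hO : ∀ n y, IsOpen (O n y) := fun n y => (hcl n _ (sep_subset _ _)).isOpen_compl
  have hyO : ∀ n y, y ∈ O n y := by
    rintro n y ⟨A, hA, hy⟩; exact hA.2 hy
  have hO' : ∀ {n y z A}, z ∈ O n y → A ∈ G n → z ∈ A → y ∈ A := by
    intro n y z A hz hA hzA
    by_contra hy
    exact hz ⟨A, ⟨hA, hy⟩, hzA⟩
  have hO'' : ∀ {n y z}, (∀ A ∈ G n, z ∈ A → y ∈ A) → z ∈ O n y := by
    rintro n y z hh ⟨A, ⟨hA, hy⟩, hzA⟩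
    exact hy (hh A hA hzA)
  let R : ℕ → ℕ → Y → Set Y := fun n m y =>
    {z | (∀ A ∈ G n, y ∈ A → z ∈ A) ∧ ∃ A ∈ G m, z ∈ A ∧ A ⊆ O n y}
  refine aux_aleph_countable (ι := ℕ × ℕ) (fun p => range (R p.1 p.2)) ?_ ?_
  · rintro ⟨n, m⟩ x
    refine ⟨O n x ∩ O m x, inter_mem ((hO n x).mem_nhds (hyO _ _)) ((hO m x).mem_nhds (hyO _ _)),
      (finite_singleton (R n m x)).subset ?_⟩
    rintro _ ⟨⟨y, rfl⟩, z, ⟨hz1, hz2⟩, hz3, A, hA, hzA, hAO⟩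
    have hxA : x ∈ O n y := hAO (hO' hz2 hA hzA)
    have e : ∀ B ∈ G n, (x ∈ B ↔ y ∈ B) := fun B hB =>
      ⟨fun hx => hO' hxA hB hx, fun hy => hO' hz1 hB (hz3 B hB hy)⟩
    have eO : O n x = O n y := by
      simp only [O]
      congr 2
      ext B
      simp only [mem_ofPred_eq]
      constructor
      · rintro ⟨a, b⟩; exact ⟨a, fun c => b ((e B a).2 c)⟩
      · rintro ⟨a, b⟩; exact ⟨a, fun c => b ((e B a).1 c)⟩
    show R n m y = R n m x
    ext w
    simp only [R, mem_ofPred_eq, eO]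
    refine and_congr_left fun _ => forall₂_congr fun B hB => ?_
    rw [e B hB]
  · intro C hC U hU hCU
    have : ∀ c ∈ C, ∃ B ∈ ⋃ p : ℕ × ℕ, range (R p.1 p.2), c ∈ B ∧ B ⊆ U := by
      intro c hc
      obtain ⟨n, A, hA, hcA, hAU⟩ := hnet c U hU (hCU hc)
      obtain ⟨m, B, hB, hcB, hBO⟩ := hnet c (O n c) (hO n c) (hyO n c)
      refine ⟨R n m c, mem_iUnion.2 ⟨(n, m), c, rfl⟩, ⟨fun _ _ h => h, B, hB, hcB, hBO⟩, ?_⟩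
      rintro z ⟨hz, -⟩
      exact hAU (hz A hA hcA)
    choose! g hg1 hg2 hg3 using this
    refine ⟨g '' C, image_subset_iff.2 hg1, (hfin C hC).image g,
      fun c hc => ⟨_, mem_image_of_mem g hc, hg2 c hc⟩, ?_⟩
    rintro z ⟨_, ⟨c, hc, rfl⟩, hz⟩
    exact hg3 c hc hz

theorem aux_lf_restrict {Y : Type u} [TopologicalSpace Y] {β : Type v} (A : β → Set Y) (P : Set β)
    (hcl : ∀ Q ⊆ P, IsClosed (⋃ q ∈ Q, A q)) :
    IsOpen {y | {q ∈ P | y ∈ A q}.Finite} ∧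
    ∀ H, IsClosed H → H ⊆ {y | {q ∈ P | y ∈ A q}.Finite} →
      LocallyFiniteFam ((fun q => A q ∩ H) '' P) := by
  have key : ∀ y, {q ∈ P | y ∈ A q}.Finite → ∃ V, IsOpen V ∧ y ∈ V ∧
      ∀ z ∈ V, {q ∈ P | z ∈ A q} ⊆ {q ∈ P | y ∈ A q} := by
    intro y _
    refine ⟨(⋃ q ∈ {q ∈ P | y ∉ A q}, A q)ᶜ, (hcl _ (sep_subset _ _)).isOpen_compl, ?_, ?_⟩
    · simp
    · rintro z hz q ⟨hq, hzq⟩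
      refine ⟨hq, ?_⟩
      by_contra hy
      exact hz (mem_biUnion (show q ∈ {q ∈ P | y ∉ A q} from ⟨hq, hy⟩) hzq)
  constructor
  · rw [isOpen_iff_mem_nhds]
    intro y hy
    obtain ⟨V, hV, hyV, hz⟩ := key y hy
    filter_upwards [hV.mem_nhds hyV] with z hzV
    exact Set.Finite.subset hy (hz z hzV)
  · intro H hH hHD y
    by_cases hy : y ∈ H
    · obtain ⟨V, hV, hyV, hz⟩ := key y (hHD hy)
      refine ⟨V, hV.mem_nhds hyV, ((hHD hy).image (fun q => A q ∩ H)).subset ?_⟩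
      rintro _ ⟨⟨q, hq, rfl⟩, z, hzV, hzq, -⟩
      exact ⟨q, hz z hzV ⟨hq, hzq⟩, rfl⟩
    · refine ⟨Hᶜ, hH.isOpen_compl.mem_nhds hy, Set.finite_empty.subset ?_⟩
      rintro _ ⟨⟨q, hq, rfl⟩, z, hzV, -, hzH⟩
      exact hzV hzH

theorem aux_contra {Y : Type u} [TopologicalSpace Y] [T2Space Y] {P : Set (Set Y)} (hP : IsHCP P)
    (p : ℕ → Y) (J : Set ℕ) (z : Y) (hz : z ∈ closure (p '' J)) (hne : ∀ j ∈ J, p j ≠ z)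
    (hinf : ∀ j ∈ J, {A ∈ P | p j ∈ closure A}.Infinite) : False := by
  classical
  have hJ : J.Nonempty := by
    by_contra hJ
    rw [not_nonempty_iff_eq_empty] at hJ
    simp [hJ] at hz
  obtain ⟨j0, hj0⟩ := hJ
  have hPinf : P.Infinite := (hinf j0 hj0).mono (sep_subset _ _)
  have : ∀ (j : ℕ) (s : Finset (Set Y)), ∃ A ∈ P, A ∉ s ∧ (j ∈ J → p j ∈ closure A) := by
    intro j s
    by_cases hj : j ∈ J
    · obtain ⟨A, hA, hs⟩ := (hinf j hj).exists_notMem_finset s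
      exact ⟨A, hA.1, hs, fun _ => hA.2⟩
    · obtain ⟨A, hA, hs⟩ := hPinf.exists_notMem_finset s
      exact ⟨A, hA, hs, fun h => (hj h).elim⟩
  choose c hc1 hc2 hc3 using this
  let L : ℕ → Finset (Set Y) := fun n => Nat.rec ∅ (fun k s => insert (c k s) s) n
  have hL : ∀ n, L (n + 1) = insert (c n (L n)) (L n) := fun n => rfl
  have hLm : Monotone L := monotone_nat_of_le_succ fun n => by
    rw [hL]; exact Finset.subset_insert _ _
  let B : ℕ → Set Y := fun n => c n (L n)
  have hlt : ∀ m n, m < n → B m ≠ B n := by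
    intro m n hmn e
    have h1 : B m ∈ L n := hLm (Nat.succ_le_of_lt hmn) (by rw [hL]; exact Finset.mem_insert_self _ _)
    rw [e] at h1
    exact hc2 _ _ h1
  have hB : Function.Injective B := by
    intro m n e
    rcases lt_trichotomy m n with h | h | h
    · exact (hlt _ _ h e).elim
    · exact h
    · exact (hlt _ _ h e.symm).elim
  have hW : ∀ j ∈ J, ∃ W, IsOpen W ∧ p j ∈ W ∧ z ∉ closure W := by
    intro j hj
    obtain ⟨U, V, hU, hV, hpU, hzV, hd⟩ := t2_separation (hne j hj)
    refine ⟨U, hU, hpU, fun hzc => ?_⟩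
    exact (hd.closure_left hV).le_bot ⟨hzc, hzV⟩
  choose! W hW1 hW2 hW3 using hW
  let S : Set Y → Set Y := fun A => {y ∈ A | ∀ j ∈ J, B j = A → y ∈ W j}
  have hSB : ∀ j ∈ J, S (B j) = W j ∩ B j := by
    intro j hj
    ext y
    constructor
    · rintro ⟨h1, h2⟩; exact ⟨h2 j hj rfl, h1⟩
    · rintro ⟨h1, h2⟩
      refine ⟨h2, fun i _ e => ?_⟩
      rw [hB e]; exact h1
  have key := hP S (fun A _ => sep_subset _ _) (B '' J) (image_subset_iff.2 fun j _ => hc1 _ _)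
  have hz' : z ∈ closure (⋃ A ∈ B '' J, S A) := by
    refine closure_minimal ?_ isClosed_closure hz
    rintro _ ⟨j, hj, rfl⟩
    have h1 : p j ∈ closure (S (B j)) := by
      rw [hSB j hj]
      exact (hW1 j hj).inter_closure ⟨hW2 j hj, hc3 _ _ hj⟩
    exact closure_mono (subset_biUnion_of_mem (u := S) (mem_image_of_mem B hj)) h1
  rw [key] at hz'
  simp only [mem_iUnion, exists_prop] at hz'
  obtain ⟨_, ⟨j, hj, rfl⟩, hzj⟩ := hz'
  rw [hSB j hj] at hzj
  exact hW3 j hj (closure_mono inter_subset_left hzj)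

/-! Vietoris topology -/

variable {X : Type u} [TopologicalSpace X]

theorem aux_open_sub {U : Set X} (hU : IsOpen U) : IsOpen {A : VHyper X | A.carrier ⊆ U} := by
  refine TopologicalSpace.isOpen_generateFrom_of_mem ⟨{U}, by simpa using hU, ?_⟩
  ext A
  simp only [VHyper.vbox, mem_ofPred_eq, Finset.coe_singleton, sUnion_singleton,
    Finset.mem_singleton, forall_eq]
  refine ⟨fun h => ⟨h, ?_⟩, fun h => h.1⟩
  obtain ⟨a, ha⟩ := A.nonempty'
  exact ⟨a, ha, h ha⟩

theorem aux_open_meet {U : Set X} (hU : IsOpen U) :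
    IsOpen {A : VHyper X | (A.carrier ∩ U).Nonempty} := by
  classical
  refine TopologicalSpace.isOpen_generateFrom_of_mem ⟨{U, univ}, by simpa using hU, ?_⟩
  ext A
  simp [VHyper.vbox, A.nonempty']

theorem aux_nhd {W : Set (VHyper X)} (hW : IsOpen W) (A : VHyper X) (hA : A ∈ W) :
    ∃ U : Set X, ∃ Vs : Set (Set X), IsOpen U ∧ Vs.Finite ∧ (∀ V ∈ Vs, IsOpen V) ∧
      A.carrier ⊆ U ∧ (∀ V ∈ Vs, (A.carrier ∩ V).Nonempty) ∧
      ∀ B : VHyper X, B.carrier ⊆ U → (∀ V ∈ Vs, (B.carrier ∩ V).Nonempty) → B ∈ W := by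
  induction hW with
  | basic s hs =>
    obtain ⟨Ps, ho, rfl⟩ := hs
    exact ⟨⋃₀ (Ps : Set (Set X)), Ps, isOpen_sUnion ho, Ps.finite_toSet, ho, hA.1, hA.2,
      fun B h1 h2 => ⟨h1, h2⟩⟩
  | univ => exact ⟨univ, ∅, isOpen_univ, finite_empty, by simp, subset_univ _, by simp, by simp⟩
  | inter s t _ _ ihs iht =>
    obtain ⟨U, Vs, h1, h2, h3, h4, h5, h6⟩ := ihs hA.1
    obtain ⟨U', Vs', h1', h2', h3', h4', h5', h6'⟩ := iht hA.2
    refine ⟨U ∩ U', Vs ∪ Vs', h1.inter h1', h2.union h2', ?_, subset_inter h4 h4', ?_, ?_⟩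
    · rintro V (hV | hV)
      · exact h3 V hV
      · exact h3' V hV
    · rintro V (hV | hV)
      · exact h5 V hV
      · exact h5' V hV
    · intro B hB hB'
      exact ⟨h6 B (hB.trans inter_subset_left) fun V hV => hB' V (Or.inl hV),
        h6' B (hB.trans inter_subset_right) fun V hV => hB' V (Or.inr hV)⟩
  | sUnion S _ ih =>
    obtain ⟨s, hs, hAs⟩ := hA
    obtain ⟨U, Vs, h1, h2, h3, h4, h5, h6⟩ := ih s hs hAs
    exact ⟨U, Vs, h1, h2, h3, h4, h5, fun B hB hB' => ⟨s, hs, h6 B hB hB'⟩⟩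

theorem aux_ext {A B : VHyper X} (h : A.carrier = B.carrier) : A = B := by
  cases A; cases B; cases h; rfl

theorem aux_t2 [T2Space X] : T2Space (VHyper X) := by
  have key : ∀ A B : VHyper X, ∀ a ∈ A.carrier, a ∉ B.carrier →
      ∃ u v : Set (VHyper X), IsOpen u ∧ IsOpen v ∧ A ∈ u ∧ B ∈ v ∧ Disjoint u v := by
    intro A B a ha hb
    obtain ⟨U, V, hU, hV, haU, hBV, hd⟩ := SeparatedNhds.of_isCompact_isCompact
      (isCompact_singleton (x := a)) B.isCompact' (disjoint_singleton_left.2 hb)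
    refine ⟨_, _, aux_open_meet hU, aux_open_sub hV, ⟨a, ha, haU rfl⟩, hBV, ?_⟩
    rw [Set.disjoint_left]
    rintro C ⟨c, hc, hcU⟩ hCV
    exact hd.le_bot ⟨hcU, hCV hc⟩
  refine ⟨fun A B hAB => ?_⟩
  by_cases h : A.carrier ⊆ B.carrier
  · have h' : ¬ B.carrier ⊆ A.carrier := fun h' => hAB (aux_ext (h.antisymm h'))
    obtain ⟨b, hb, hba⟩ := not_subset.1 h'
    obtain ⟨u, v, h1, h2, h3, h4, h5⟩ := key B A b hb hba
    exact ⟨v, u, h2, h1, h4, h3, h5.symm⟩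
  · obtain ⟨a, ha, hab⟩ := not_subset.1 h
    exact key A B a ha hab

theorem aux_union_compact {K : Set (VHyper X)} (hK : IsCompact K) :
    IsCompact (⋃ A ∈ K, A.carrier) := by
  classical
  refine isCompact_of_finite_subcover fun {ι} U hU hs => ?_
  have : ∀ A ∈ K, ∃ t : Finset ι, A.carrier ⊆ ⋃ i ∈ t, U i := fun A hA =>
    A.isCompact'.elim_finite_subcover U hU ((subset_biUnion_of_mem (u := VHyper.carrier) hA).trans hs)
  choose! t ht using this
  obtain ⟨s, hsK, hs'⟩ := hK.elim_nhds_subcover (fun A => {B | B.carrier ⊆ ⋃ i ∈ t A, U i})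
    (fun A hA => (aux_open_sub (isOpen_biUnion fun i _ => hU i)).mem_nhds (ht A hA))
  refine ⟨s.biUnion t, ?_⟩
  refine iUnion₂_subset fun A hA x hx => ?_
  obtain ⟨B, hB, hAB⟩ := mem_iUnion₂.1 (hs' hA)
  obtain ⟨i, hi, hxi⟩ := mem_iUnion₂.1 (hAB hx)
  exact mem_iUnion₂.2 ⟨i, Finset.mem_biUnion.2 ⟨B, hB, hi⟩, hxi⟩

theorem aux_one_five_basic [T2Space X] [RegularSpace X] {P : Set (Set X)} (hP : IsKNetwork P)
    {K : Set (VHyper X)} (hK : IsCompact K) (U : Set X) (Vs : Set (Set X)) (hU : IsOpen U)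
    (hVf : Vs.Finite) (hV : ∀ V ∈ Vs, IsOpen V)
    (hKU : ∀ A ∈ K, A.carrier ⊆ U ∧ ∀ V ∈ Vs, (A.carrier ∩ V).Nonempty) :
    ∃ Q : Set (Set X), Q ⊆ P ∧ Q.Finite ∧ ∀ A ∈ K,
      A.carrier ⊆ ⋃₀ Q ∧ ∀ B : VHyper X, B.carrier ⊆ ⋃₀ {q ∈ Q | (A.carrier ∩ q).Nonempty} →
        (∀ q ∈ {q ∈ Q | (A.carrier ∩ q).Nonempty}, (B.carrier ∩ q).Nonempty) →
        B.carrier ⊆ U ∧ ∀ V ∈ Vs, (B.carrier ∩ V).Nonempty := by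
  have hM := aux_union_compact hK
  set M := ⋃ A ∈ K, A.carrier with hMdef
  have hAM : ∀ A ∈ K, A.carrier ⊆ M := fun A hA => subset_biUnion_of_mem (u := VHyper.carrier) hA
  obtain ⟨Q0, hQ0, hQ0f, hc0, hu0⟩ := hP M hM U hU (iUnion₂_subset fun A hA => (hKU A hA).1)
  have : ∀ V ∈ Vs, ∃ Q : Set (Set X), Q ⊆ P ∧ Q.Finite ∧ ⋃₀ Q ⊆ U ∩ V ∧
      ∀ A ∈ K, ∃ q ∈ Q, (A.carrier ∩ q).Nonempty := by
    intro V hVV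
    have hW : ∀ A ∈ K, ∃ W, IsOpen W ∧ (A.carrier ∩ W).Nonempty ∧ closure W ⊆ V := by
      intro A hA
      obtain ⟨a, ha, haV⟩ := (hKU A hA).2 V hVV
      obtain ⟨W, h1, h2, h3⟩ := (isCompact_singleton (x := a)).exists_isOpen_closure_subset
        ((hV V hVV).mem_nhdsSet.2 (singleton_subset_iff.2 haV))
      exact ⟨W, h1, ⟨a, ha, h2 rfl⟩, h3⟩
    choose! W hW1 hW2 hW3 using hW
    obtain ⟨s, hsK, hs⟩ := hK.elim_nhds_subcover (fun A => {B | (B.carrier ∩ W A).Nonempty})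
      (fun A hA => (aux_open_meet (hW1 A hA)).mem_nhds (hW2 A hA))
    have hcl : IsClosed (⋃ A ∈ s, closure (W A)) :=
      isClosed_biUnion_finset fun _ _ => isClosed_closure
    obtain ⟨Q, hQ, hQf, hc, hu⟩ := hP (M ∩ ⋃ A ∈ s, closure (W A)) (hM.inter_right hcl)
      (U ∩ V) (hU.inter (hV V hVV)) (by
        rintro x ⟨hx, hx'⟩
        obtain ⟨A, hA, hxA⟩ := mem_iUnion₂.1 hx'
        exact ⟨hu0 (hc0 hx), hW3 A (hsK A hA) hxA⟩)
    refine ⟨Q, hQ, hQf, hu, fun A hA => ?_⟩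
    obtain ⟨B, hB, a, ha, haW⟩ := mem_iUnion₂.1 (hs hA)
    obtain ⟨q, hq, haq⟩ := hc ⟨hAM A hA ha, mem_iUnion₂.2 ⟨B, hB, subset_closure haW⟩⟩
    exact ⟨q, hq, a, ha, haq⟩
  choose! Q hQ1 hQ2 hQ3 hQ4 using this
  refine ⟨Q0 ∪ ⋃ V ∈ Vs, Q V, union_subset hQ0 (iUnion₂_subset hQ1), hQ0f.union (hVf.biUnion hQ2),
    fun A hA => ⟨((hAM A hA).trans hc0).trans (sUnion_mono subset_union_left), ?_⟩⟩
  intro B hB1 hB2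
  constructor
  · intro b hb
    obtain ⟨q, ⟨hq | hq, -⟩, hbq⟩ := hB1 hb
    · exact hu0 ⟨q, hq, hbq⟩
    · obtain ⟨V, hVV, hqV⟩ := mem_iUnion₂.1 hq
      exact (hQ3 V hVV ⟨q, hqV, hbq⟩).1
  · intro V hVV
    obtain ⟨q, hq, hAq⟩ := hQ4 V hVV A hA
    obtain ⟨b, hb, hbq⟩ := hB2 q ⟨Or.inr (mem_iUnion₂.2 ⟨V, hVV, hq⟩), hAq⟩
    exact ⟨b, hb, (hQ3 V hVV ⟨q, hq, hbq⟩).2⟩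

theorem aux_one_five [T2Space X] [RegularSpace X] (h : IsAlephSpace X) :
    IsAlephSpace (VHyper X) := by
  classical
  obtain ⟨P, hm, hlf, hk⟩ := aux_aleph_mono h
  refine ⟨fun n => boxFamily (P n), ?_, ?_⟩
  · intro n A
    choose O hO hOf using hlf n
    obtain ⟨s, hs, hAs⟩ := A.isCompact'.elim_nhds_subcover (fun x => interior (O x))
      (fun x _ => interior_mem_nhds.2 (hO x))
    have ho : IsOpen (⋃ x ∈ s, interior (O x)) := isOpen_biUnion fun _ _ => isOpen_interior
    refine ⟨_, (aux_open_sub ho).mem_nhds hAs, ?_⟩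
    have hT : (⋃ x ∈ s, {p ∈ P n | (O x ∩ p).Nonempty}).Finite :=
      s.finite_toSet.biUnion fun x _ => hOf x
    have hT2 : {Q : Finset (Set X) | (Q : Set (Set X)) ⊆
        ⋃ x ∈ s, {p ∈ P n | (O x ∩ p).Nonempty}}.Finite := by
      refine (hT.toFinset.powerset.finite_toSet).subset ?_
      intro Q hQ
      simp only [Finset.coe_powerset, mem_preimage, mem_powerset_iff, Finite.coe_toFinset]
      exact hQ
    refine (hT2.image VHyper.vbox).subset ?_
    rintro _ ⟨⟨Ps, -, hPs, rfl⟩, B, hB, hB1, hB2⟩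
    refine ⟨Ps, ?_, rfl⟩
    intro p hp
    obtain ⟨b, hb, hbp⟩ := hB2 p hp
    obtain ⟨x, hx, hbx⟩ := mem_iUnion₂.1 (hB hb)
    exact mem_iUnion₂.2 ⟨x, hx, hPs hp, b, interior_subset hbx, hbp⟩
  · intro C hC W hW hCW
    have : T2Space (VHyper X) := aux_t2
    have := fun A (hA : A ∈ C) => aux_nhd hW A (hCW hA)
    choose! U Vs h1 h2 h3 h4 h5 h6 using this
    let N : VHyper X → Set (VHyper X) := fun A =>
      {B | B.carrier ⊆ U A} ∩ ⋂ V ∈ Vs A, {B | (B.carrier ∩ V).Nonempty}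
    have hN : ∀ A ∈ C, IsOpen (N A) := fun A hA =>
      (aux_open_sub (h1 A hA)).inter ((h2 A hA).isOpen_biInter fun V hV => aux_open_meet (h3 A hA V hV))
    obtain ⟨s, hsC, hs⟩ := hC.elim_nhds_subcover N
      (fun A hA => (hN A hA).mem_nhds ⟨h4 A hA, mem_iInter₂.2 (h5 A hA)⟩)
    obtain ⟨K, hK1, hK2, hK3⟩ := hC.finite_compact_cover s N (fun A hA => hN A (hsC A hA)) hs
    have := fun A (hA : A ∈ s) => aux_one_five_basic hk (hK1 A) (U A) (Vs A) (h1 A (hsC A hA))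
      (h2 A (hsC A hA)) (h3 A (hsC A hA))
      (fun B hB => ⟨(hK2 A hB).1, fun V hV => mem_iInter₂.1 (hK2 A hB).2 V hV⟩)
    choose! Q hQ1 hQ2 hQ3 using this
    let F : VHyper X → Set (Set (VHyper X)) := fun A =>
      {b | ∃ Ps : Finset (Set X), (Ps : Set (Set X)) ⊆ Q A ∧ b = VHyper.vbox Ps ∧ Ps.Nonempty ∧ b ⊆ W}
    refine ⟨⋃ A ∈ s, F A, ?_, ?_, ?_, ?_⟩
    · refine iUnion₂_subset fun A hA => ?_
      rintro _ ⟨Ps, hPs, rfl, hne, -⟩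
      obtain ⟨n, hn⟩ := aux_union_mono hm Ps.finite_toSet (hPs.trans (hQ1 A hA))
      exact mem_iUnion.2 ⟨n, Ps, hne, hn, rfl⟩
    · refine s.finite_toSet.biUnion fun A hA => ?_
      have hT2 : {R : Finset (Set X) | (R : Set (Set X)) ⊆ Q A}.Finite := by
        refine ((hQ2 A hA).toFinset.powerset.finite_toSet).subset ?_
        intro R hR
        simp only [Finset.coe_powerset, mem_preimage, mem_powerset_iff, Finite.coe_toFinset]
        exact hR
      refine (hT2.image VHyper.vbox).subset ?_
      rintro _ ⟨Ps, hPs, rfl, -⟩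
      exact ⟨Ps, hPs, rfl⟩
    · intro B hB
      rw [hK3] at hB
      obtain ⟨A, hA, hBA⟩ := mem_iUnion₂.1 hB
      obtain ⟨hc, hh⟩ := hQ3 A hA B hBA
      have hf : {q ∈ Q A | (B.carrier ∩ q).Nonempty}.Finite := (hQ2 A hA).subset (sep_subset _ _)
      have hcov : B.carrier ⊆ ⋃₀ {q ∈ Q A | (B.carrier ∩ q).Nonempty} := by
        intro b hb
        obtain ⟨q, hq, hbq⟩ := hc hb
        exact ⟨q, ⟨hq, b, hb, hbq⟩, hbq⟩
      refine ⟨VHyper.vbox hf.toFinset, mem_iUnion₂.2 ⟨A, hA, hf.toFinset, ?_, rfl, ?_, ?_⟩, ?_⟩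
      · rw [Finite.coe_toFinset]; exact sep_subset _ _
      · obtain ⟨b, hb⟩ := B.nonempty'
        obtain ⟨q, hq, -⟩ := hcov hb
        exact ⟨q, hf.mem_toFinset.2 hq⟩
      · rintro D ⟨hD1, hD2⟩
        rw [Finite.coe_toFinset] at hD1
        obtain ⟨h7, h8⟩ := hh D hD1 (fun q hq => hD2 q (hf.mem_toFinset.2 hq))
        exact h6 A (hsC A hA) D h7 h8
      · refine ⟨?_, fun q hq => (hf.mem_toFinset.1 hq).2⟩
        rw [Finite.coe_toFinset]; exact hcov
    · rintro D ⟨b, hb, hD⟩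
      obtain ⟨A, hA, Ps, -, -, -, hbW⟩ := mem_iUnion₂.1 hb
      exact hbW hD

/-! Pairs -/

theorem aux_encard_pair (x y : X) : ({x, y} : Set X).encard ≤ 2 := by
  refine (Set.encard_insert_le _ _).trans ?_
  rw [Set.encard_singleton]
  exact le_of_eq one_add_one_eq_two

/-- The two point set `{x, y}`. -/
def auxPair (x y : X) : VFin2 X :=
  ⟨⟨{x, y}, (Set.toFinite _).isCompact, ⟨x, by simp⟩⟩, aux_encard_pair x y⟩

theorem auxPair_carrier (x y : X) : (auxPair x y).1.carrier = {x, y} := rfl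

/-- inclusion of `ℱ₂(X)` -/
def auxVal2 (A : VFin2 X) : VHyper X := A.1

/-- inclusion of `ℱ(X)` -/
def auxVal (A : VFin X) : VHyper X := A.1

/-- inclusion of `ℱ₂(X)` into `ℱ(X)` -/
def auxIncl (A : VFin2 X) : VFin X :=
  ⟨A.1, Set.finite_of_encard_le_coe (k := 2) A.2⟩

theorem aux_val_inducing2 : IsInducing (auxVal2 : VFin2 X → VHyper X) := ⟨rfl⟩

theorem aux_val_inducing : IsInducing (auxVal : VFin X → VHyper X) := ⟨rfl⟩

theorem aux_incl_inducing : IsInducing (auxIncl : VFin2 X → VFin X) :=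
  (IsInducing.of_comp_iff aux_val_inducing).1 (show IsInducing (auxVal2 : VFin2 X → VHyper X) from ⟨rfl⟩)

theorem aux_pair_cont : Continuous (fun p : X × X => auxPair p.1 p.2) := by
  rw [aux_val_inducing2.continuous_iff]
  refine continuous_generateFrom_iff.2 ?_
  rintro _ ⟨Ps, ho, rfl⟩
  have e : (auxVal2 ∘ fun p : X × X => auxPair p.1 p.2) ⁻¹' VHyper.vbox Ps =
      (Prod.fst ⁻¹' (⋃₀ (Ps : Set (Set X))) ∩ Prod.snd ⁻¹' (⋃₀ (Ps : Set (Set X)))) ∩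
        ⋂ P ∈ (Ps : Set (Set X)), (Prod.fst ⁻¹' P ∪ Prod.snd ⁻¹' P) := by
    ext ⟨x, y⟩
    simp only [VHyper.vbox, mem_preimage, Function.comp, auxVal2, mem_ofPred_eq, auxPair_carrier,
      mem_inter_iff, mem_iInter, mem_union, insert_subset_iff, singleton_subset_iff]
    refine and_congr Iff.rfl (forall₂_congr fun P hP => ?_)
    constructor
    · rintro ⟨z, (rfl | rfl), hz⟩
      · exact Or.inl hz
      · exact Or.inr hz
    · rintro (h | h)
      · exact ⟨x, by simp, h⟩
      · exact ⟨y, by simp, h⟩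
  rw [e]
  have hU : IsOpen (⋃₀ (Ps : Set (Set X))) := isOpen_sUnion ho
  exact ((hU.preimage continuous_fst).inter (hU.preimage continuous_snd)).inter
    (Ps.finite_toSet.isOpen_biInter fun P hP =>
      ((ho P hP).preimage continuous_fst).union ((ho P hP).preimage continuous_snd))

theorem aux_pair_inducing [T1Space X] (a : X) : IsInducing (auxPair a) := by
  have hc : Continuous (auxPair a) := aux_pair_cont.comp (Continuous.prodMk_right a)
  rw [isInducing_iff_nhds]
  intro y
  refine le_antisymm (map_le_iff_le_comap.1 hc.continuousAt) ?_
  intro U hU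
  obtain ⟨U', hU'U, hU', hy⟩ := mem_nhds_iff.1 hU
  by_cases hya : y = a
  · refine mem_comap.2 ⟨auxVal2 ⁻¹' {A : VHyper X | A.carrier ⊆ U'},
      ((aux_open_sub hU').preimage aux_val_inducing2.continuous).mem_nhds ?_, ?_⟩
    · rintro z (rfl | rfl)
      · exact hya ▸ hy
      · exact hy
    · intro z hz
      exact hU'U (hz (show z ∈ ({a, z} : Set X) by simp))
  · refine mem_comap.2 ⟨auxVal2 ⁻¹' {A : VHyper X | (A.carrier ∩ (U' ∩ {a}ᶜ)).Nonempty},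
      ((aux_open_meet (hU'.inter isOpen_compl_singleton)).preimage
        aux_val_inducing2.continuous).mem_nhds ?_, ?_⟩
    · exact ⟨y, show y ∈ ({a, y} : Set X) by simp, hy, hya⟩
    · rintro z ⟨w, (rfl | rfl), hw, hwa⟩
      · exact (hwa rfl).elim
      · exact hU'U hw

theorem aux_pair_ne {a b y : X} (h : a ≠ b) : auxPair a y ≠ auxPair b y := by
  intro e
  have e' : ({a, y} : Set X) = {b, y} := congrArg (fun A : VFin2 X => A.1.carrier) e
  have h1 : a ∈ ({b, y} : Set X) := e' ▸ (by simp)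
  have h2 : b ∈ ({a, y} : Set X) := e' ▸ (by simp)
  rcases h1 with h1 | h1
  · exact h h1
  · rcases h2 with h2 | h2
    · exact h h2.symm
    · exact h (h1.trans h2.symm)

theorem aux_case1 [T2Space X] [RegularSpace X] (h : HasSigmaHCPKNetwork (VFin2 X))
    (K0 : Set X) (hK0 : IsCompact K0) (hinf : K0.Infinite) : IsAlephSpace X := by
  have : T2Space (VHyper X) := aux_t2
  have : T2Space (VFin2 X) :=
    inferInstanceAs (T2Space {A : VHyper X // A.carrier.encard ≤ 2})
  -- the sequence and its accumulation point
  let x : ℕ → X := fun j => (hinf.natEmbedding K0 j : X)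
  have hxK : ∀ j, x j ∈ K0 := fun j => (hinf.natEmbedding K0 j).2
  have hxinj : Function.Injective x :=
    Subtype.val_injective.comp (hinf.natEmbedding K0).injective
  obtain ⟨z, hzK, hz⟩ := (Set.infinite_range_of_injective hxinj).exists_accPt_of_subset_isCompact
    hK0 (range_subset_iff.2 hxK)
  rw [accPt_principal_iff_clusterPt, ← mem_closure_iff_clusterPt] at hz
  obtain ⟨G, hGm, hGcl, hGk⟩ := aux_cpk (aux_hasHCP_inducing (aux_pair_inducing z) h)
  obtain ⟨P, hPm, hP, hPk⟩ := aux_hcp_mono h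
  let A : ℕ → Set (VFin2 X) → Set X := fun j p => closure (auxPair (x j) ⁻¹' p)
  have hA : ∀ n j, ∀ Q ⊆ P n, IsClosed (⋃ q ∈ Q, A j q) := by
    intro n j Q hQ
    have key := aux_hcp_preimage (aux_pair_inducing (x j)) (hP n) id (fun _ _ => subset_rfl)
      ((fun q => auxPair (x j) ⁻¹' q) '' Q) (image_mono hQ)
    rw [biUnion_image, biUnion_image] at key
    have e : (⋃ q ∈ Q, A j q) = closure (⋃ q ∈ Q, id (auxPair (x j) ⁻¹' q)) := key.symm
    rw [e]; exact isClosed_closure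
  let E : ℕ → ℕ → Set X := fun n j => {y | {q ∈ P n | y ∈ A j q}.Finite}
  have hE : ∀ n j, IsOpen (E n j) := fun n j => (aux_lf_restrict (A j) (P n) (hA n j)).1
  let H : ℕ → ℕ → ℕ → Set X := fun n j i => ⋃₀ {g ∈ G i | g ⊆ E n j}
  have hH : ∀ n j i, IsClosed (H n j i) := fun n j i => hGcl i _ (sep_subset _ _)
  have hHE : ∀ n j i, H n j i ⊆ E n j := fun n j i => sUnion_subset fun g hg => hg.2
  refine aux_aleph_countable (ι := ℕ × ℕ × ℕ)
    (fun t => (fun q => A t.2.1 q ∩ H t.1 t.2.1 t.2.2) '' P t.1)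
    (fun t => (aux_lf_restrict (A t.2.1) (P t.1) (hA t.1 t.2.1)).2 _ (hH _ _ _) (hHE _ _ _)) ?_
  intro C hC U hU hCU
  obtain ⟨V, hV, hCV, hVU⟩ := hC.exists_isOpen_closure_subset (hU.mem_nhdsSet.2 hCU)
  -- separate
  obtain ⟨N, M, hN, hM, hzN, hCM, hNM⟩ : ∃ N M : Set X, IsOpen N ∧ IsOpen M ∧ z ∈ N ∧ C ⊆ M ∧
      ∀ a ∈ N, ∀ y, a ∈ N ∪ M → y ∈ N ∪ M → (a ∈ M ∨ y ∈ M) → y ∈ V := by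
    by_cases hzC : z ∈ C
    · exact ⟨V, V, hV, hV, hCV hzC, hCV, fun a _ y _ hy _ => by simpa using hy⟩
    · obtain ⟨N, M, hN, hM, hzN, hCM, hd⟩ := SeparatedNhds.of_isCompact_isCompact
        (isCompact_singleton (x := z)) hC (disjoint_singleton_left.2 hzC)
      refine ⟨N, M ∩ V, hN, hM.inter hV, hzN rfl, subset_inter hCM hCV, ?_⟩
      rintro a ha y - - (h1 | h1)
      · exact (hd.le_bot ⟨ha, h1.1⟩).elim
      · exact h1.2
  obtain ⟨N', hN', hzN', hN'N⟩ := (isCompact_singleton (x := z)).exists_isOpen_closure_subset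
    (hN.mem_nhdsSet.2 (singleton_subset_iff.2 hzN))
  have hzN' : z ∈ N' := hzN' rfl
  have hK' : IsCompact (K0 ∩ closure N') := hK0.inter_right isClosed_closure
  have hqc : IsCompact ((fun p : X × X => auxPair p.1 p.2) '' ((K0 ∩ closure N') ×ˢ C)) :=
    (hK'.prod hC).image aux_pair_cont
  let W : Set (VFin2 X) := auxVal2 ⁻¹' ({B : VHyper X | B.carrier ⊆ N ∪ M} ∩
    {B : VHyper X | (B.carrier ∩ M).Nonempty})
  have hW : IsOpen W := ((aux_open_sub (hN.union hM)).inter (aux_open_meet hM)).preimage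
    aux_val_inducing2.continuous
  obtain ⟨F, hF, hFf, hFc, hFu⟩ := hPk _ hqc W hW (by
    rintro _ ⟨⟨k, c⟩, ⟨⟨hk1, hk2⟩, hc⟩, rfl⟩
    refine ⟨?_, ⟨c, show c ∈ ({k, c} : Set X) by simp, hCM hc⟩⟩
    rintro w (rfl | rfl)
    · exact Or.inl (hN'N hk2)
    · exact Or.inr (hCM hc))
  obtain ⟨n, hn⟩ := aux_union_mono hPm hFf hF
  let J : Set ℕ := {j | x j ≠ z ∧ x j ∈ N'}
  have hzJ : z ∈ closure (x '' J) := by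
    have h1 : z ∈ closure (N' ∩ (range x \ {z})) := hN'.inter_closure ⟨hzN', hz⟩
    refine closure_mono ?_ h1
    rintro _ ⟨h2, ⟨j, rfl⟩, h3⟩
    exact ⟨j, ⟨h3, h2⟩, rfl⟩
  have hcov : C ⊆ ⋃ j : J, E n j := by
    intro y _
    by_contra hy
    simp only [mem_iUnion, not_exists] at hy
    refine aux_contra (hP n) (fun j => auxPair (x j) y) J (auxPair z y) ?_
      (fun j hj => aux_pair_ne hj.1) ?_
    · have hc : Continuous (fun a : X => auxPair a y) :=
        aux_pair_cont.comp (Continuous.prodMk_left y)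
      have := image_closure_subset_closure_image hc (mem_image_of_mem _ hzJ)
      rwa [image_image] at this
    · intro j hj
      refine Set.Infinite.mono ?_ (hy ⟨j, hj⟩)
      rintro q ⟨hq, hyq⟩
      refine ⟨hq, ?_⟩
      have := image_closure_subset_closure_image (aux_pair_inducing (x j)).continuous
        (mem_image_of_mem _ hyq)
      exact closure_mono (image_preimage_subset _ _) this
  obtain ⟨t, ht⟩ := hC.elim_finite_subcover (fun j : J => E n j) (fun j => hE n j) hcov
  obtain ⟨K, hK1, hK2, hK3⟩ := hC.finite_compact_cover t (fun j : J => E n j)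
    (fun j _ => hE n j) ht
  have hi : ∀ j : J, ∃ i, K j ⊆ H n j i := by
    intro j
    obtain ⟨Q, hQ, hQf, hQc, hQu⟩ := hGk (K j) (hK1 j) (E n j) (hE n j) (hK2 j)
    obtain ⟨i, hi⟩ := aux_union_mono hGm hQf hQ
    refine ⟨i, fun y hy => ?_⟩
    obtain ⟨g, hg, hyg⟩ := hQc hy
    exact ⟨g, ⟨hi hg, fun w hw => hQu ⟨g, hg, hw⟩⟩, hyg⟩
  choose i hi using hi
  refine ⟨⋃ j ∈ t, (fun q => A j q ∩ H n j (i j)) '' F, ?_, ?_, ?_, ?_⟩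
  · refine iUnion₂_subset fun j _ => ?_
    rintro _ ⟨q, hq, rfl⟩
    exact mem_iUnion.2 ⟨(n, (j : ℕ), i j), q, hn hq, rfl⟩
  · exact t.finite_toSet.biUnion fun j _ => hFf.image _
  · intro y hy
    have hy' := hy
    rw [hK3] at hy'
    obtain ⟨j, hj, hyj⟩ := mem_iUnion₂.1 hy'
    obtain ⟨q, hq, hyq⟩ := hFc ⟨(x j, y), ⟨⟨hxK j, subset_closure j.2.2⟩, hy⟩, rfl⟩
    exact ⟨_, mem_iUnion₂.2 ⟨j, hj, q, hq, rfl⟩, subset_closure hyq, hi j hyj⟩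
  · rintro y ⟨_, hB, hy⟩
    obtain ⟨j, hj, q, hq, rfl⟩ := mem_iUnion₂.1 hB
    refine hVU (closure_mono ?_ hy.1)
    intro w hw
    obtain ⟨h1, v, hv, hvM⟩ := hFu ⟨q, hq, hw⟩
    have hj1 : x j ∈ N := hN'N (subset_closure j.2.2)
    refine hNM (x j) hj1 w (Or.inl hj1) (h1 (show w ∈ ({x j, w} : Set X) by simp)) ?_
    rcases hv with hv | hv
    · exact Or.inl (hv ▸ hvM)
    · exact Or.inr (hv ▸ hvM)

theorem aux_two_one [T2Space X] [RegularSpace X] (h : HasSigmaHCPKNetwork (VFin2 X)) :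
    IsAlephSpace X := by
  by_cases hc : ∀ C : Set X, IsCompact C → C.Finite
  · rcases isEmpty_or_nonempty X with hX | ⟨⟨a⟩⟩
    · refine ⟨fun _ => ∅, fun _ y => (hX.false y).elim, fun C _ U _ _ =>
        ⟨∅, empty_subset _, finite_empty, fun y => (hX.false y).elim, fun y => (hX.false y).elim⟩⟩
    · exact aux_case2 (aux_hasHCP_inducing (aux_pair_inducing a) h) hc
  · push Not at hc
    obtain ⟨K, hK, hi⟩ := hc
    exact aux_case1 h K hK hi

end Helpers

/-- TFAE: `X` is an ℵ-space; `ℱ₂(X)` has a σ-HCP k-network; `ℱ(X)` has a σ-HCP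
k-network; `ℱ(X)` is an ℵ-space; `𝒦(X)` is an ℵ-space. -/
theorem statement4 {X : Type*} [TopologicalSpace X] [T2Space X] [RegularSpace X] :
    List.TFAE [IsAlephSpace X,
      HasSigmaHCPKNetwork (VFin2 X),
      HasSigmaHCPKNetwork (VFin X),
      IsAlephSpace (VFin X),
      IsAlephSpace (VHyper X)] := by
  tfae_have 1 → 5 := aux_one_five
  tfae_have 5 → 4 := aux_aleph_inducing aux_val_inducing
  tfae_have 4 → 3 := by
    rintro ⟨P, h1, h2⟩
    exact ⟨P, fun n => aux_lf_hcp (h1 n), h2⟩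
  tfae_have 3 → 2 := aux_hasHCP_inducing aux_incl_inducing
  tfae_have 2 → 1 := aux_two_one
  tfae_finish
end

section
/- Let X be a regular T2 space containing a closed copy of the sequential fan S_ω. Then ℱ₂(X), the space of nonempty subsets of X of cardinality at most 2 with the Vietoris topology, contains a closed copy of the Arens space S₂. -/
open TopologicalSpace Set

open OnePoint in
/-- The identification relation on the sum `⨁_{n ∈ ℕ}` of convergent sequences
(`ℕ × OnePoint ℕ`, with `ℕ` discrete): all limit points `(n, ∞)` are identified. -/
def fanSetoid : Setoid (ℕ × OnePoint ℕ) where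
  r a b := a = b ∨ (a.2 = ∞ ∧ b.2 = ∞)
  iseqv := by
    constructor
    · intro a; exact Or.inl rfl
    · rintro a b (rfl | ⟨h1, h2⟩)
      · exact Or.inl rfl
      · exact Or.inr ⟨h2, h1⟩
    · rintro a b c (rfl | ⟨h1, h2⟩) (rfl | ⟨h3, h4⟩)
      · exact Or.inl rfl
      · exact Or.inr ⟨h3, h4⟩
      · exact Or.inr ⟨h1, h2⟩
      · exact Or.inr ⟨h1, h4⟩

/-- The sequential fan `S_ω`: the quotient of the topological sum of countably many
nontrivial convergent sequences obtained by identifying all limit points. -/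
def SeqFanOmega := Quotient fanSetoid

/-- `S_ω` carries the quotient topology. -/
instance : TopologicalSpace SeqFanOmega :=
  TopologicalSpace.coinduced (Quotient.mk fanSetoid) inferInstance

/-- The underlying set of the Arens space `S₂`: `none` is the point `∞`,
`some (n, ∞)` is the point `x_n`, and `some (n, m)` is the isolated point `x_{n,m}`. -/
def Arens := Option (ℕ × OnePoint ℕ)

namespace Arens

/-- The point `∞` of the Arens space. -/
def pt : Arens := none

/-- The point `x_n` of the Arens space. -/
def x (n : ℕ) : Arens := some (n, OnePoint.infty)

/-- The isolated point `x_{n,m}` of the Arens space. -/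
def xx (n m : ℕ) : Arens := some (n, (m : OnePoint ℕ))

/-- Openness in the Arens space: a set `U` is open iff for every `x_n ∈ U` cofinitely many
`x_{n,m}` lie in `U`, and if `∞ ∈ U` then `x_n ∈ U` for all sufficiently large `n`. -/
def ArensOpen (U : Set Arens) : Prop :=
  (∀ n : ℕ, x n ∈ U → {m : ℕ | xx n m ∈ U}ᶜ.Finite) ∧
  (pt ∈ U → ∃ k : ℕ, ∀ n > k, x n ∈ U)

/-- The Arens space topology. -/
instance : TopologicalSpace Arens where
  IsOpen := ArensOpen
  isOpen_univ := by
    constructor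
    · intro n _
      simp
    · exact fun _ => ⟨0, fun n _ => trivial⟩
  isOpen_inter := by
    rintro s t ⟨hs1, hs2⟩ ⟨ht1, ht2⟩
    constructor
    · intro n hn
      refine ((hs1 n hn.1).union (ht1 n hn.2)).subset ?_
      intro m hm
      by_cases h : xx n m ∈ s
      · exact Or.inr fun hc => hm ⟨h, hc⟩
      · exact Or.inl h
    · intro hn
      obtain ⟨k1, h1⟩ := hs2 hn.1
      obtain ⟨k2, h2⟩ := ht2 hn.2
      exact ⟨max k1 k2, fun n hgt =>
        ⟨h1 n (lt_of_le_of_lt (le_max_left _ _) hgt),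
         h2 n (lt_of_le_of_lt (le_max_right _ _) hgt)⟩⟩
  isOpen_sUnion := by
    intro S hS
    constructor
    · intro n hn
      obtain ⟨t, htS, hnt⟩ := hn
      refine ((hS t htS).1 n hnt).subset ?_
      intro m hm
      exact fun hc => hm ⟨t, htS, hc⟩
    · intro hn
      obtain ⟨t, htS, hnt⟩ := hn
      obtain ⟨k, hk⟩ := (hS t htS).2 hnt
      exact ⟨k, fun n hgt => ⟨t, htS, hk n hgt⟩⟩

end Arens

namespace S5

open Filter Topology

variable {X : Type*} [TopologicalSpace X]

lemma isOpen_hit {U : Set X} (hU : IsOpen U) :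
    IsOpen {A : VFin2 X | (A.1.carrier ∩ U).Nonempty} := by
  classical
  have h1 : IsOpen (VHyper.vbox ({U, univ} : Finset (Set X))) :=
    isOpen_generateFrom_of_mem ⟨{U, univ}, by simp [hU], rfl⟩
  have h2 := h1.preimage (continuous_subtype_val (p := fun A : VHyper X => A.carrier.encard ≤ 2))
  refine (congrArg (IsOpen (X := VFin2 X)) ?_).mpr h2
  ext A
  have := A.1.nonempty'
  constructor
  · intro hs
    refine ⟨by simp, ?_⟩
    intro P hP
    rcases Finset.mem_insert.1 hP with rfl | hP
    · exact hs
    · rw [Finset.mem_singleton.1 hP, inter_univ]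
      exact this
  · exact fun hs => hs.2 U (by simp)

lemma isOpen_sub {U : Set X} (hU : IsOpen U) :
    IsOpen {A : VFin2 X | A.1.carrier ⊆ U} := by
  classical
  have h1 : IsOpen (VHyper.vbox ({U} : Finset (Set X))) :=
    isOpen_generateFrom_of_mem ⟨{U}, by simp [hU], rfl⟩
  have h2 := h1.preimage (continuous_subtype_val (p := fun A : VHyper X => A.carrier.encard ≤ 2))
  refine (congrArg (IsOpen (X := VFin2 X)) ?_).mpr h2
  ext A
  have h := A.1.nonempty'
  simp only [VHyper.vbox, mem_ofPred_eq, mem_preimage, Finset.coe_singleton, sUnion_singleton,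
    Finset.mem_singleton, forall_eq]
  constructor
  · intro hs
    exact ⟨hs, by rwa [inter_eq_left.2 hs]⟩
  · exact fun hs => hs.1

lemma ext2 {A B : VFin2 X} (h : A.1.carrier = B.1.carrier) : A = B := by
  obtain ⟨⟨a, _, _⟩, _⟩ := A
  obtain ⟨⟨b, _, _⟩, _⟩ := B
  simp only at h
  subst h
  rfl

lemma sep [T2Space X] {A B : VFin2 X} (h : ¬ A.1.carrier ⊆ B.1.carrier) :
    ∃ u v : Set (VFin2 X), IsOpen u ∧ IsOpen v ∧ A ∈ u ∧ B ∈ v ∧ Disjoint u v := by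
  obtain ⟨a, ha, hb⟩ := not_subset.1 h
  obtain ⟨U, V, hU, hV, haU, hBV, hd⟩ := SeparatedNhds.of_isCompact_isCompact
    (isCompact_singleton (x := a)) B.1.isCompact' (by simpa using hb)
  refine ⟨_, _, isOpen_hit hU, isOpen_sub hV, ⟨a, ha, haU rfl⟩, hBV, ?_⟩
  rw [Set.disjoint_left]
  rintro C ⟨c, hc, hcU⟩ hC
  exact Set.disjoint_left.1 hd hcU (hC hc)

instance [T2Space X] : T2Space (VFin2 X) where
  t2 A B hAB := by
    by_cases h : A.1.carrier ⊆ B.1.carrier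
    · have h' : ¬ B.1.carrier ⊆ A.1.carrier := fun h' => hAB (ext2 (h.antisymm h'))
      obtain ⟨u, v, hu, hv, h1, h2, h3⟩ := sep h'
      exact ⟨v, u, hv, hu, h2, h1, h3.symm⟩
    · exact sep h

def pair (a b : X) : VFin2 X :=
  ⟨⟨{a, b}, (Set.toFinite _).isCompact, ⟨a, by simp⟩⟩, (Set.encard_insert_le _ _).trans (by rw [Set.encard_singleton]; norm_num)⟩

lemma pair_carrier (a b : X) : (pair a b).1.carrier = {a, b} := rfl

lemma continuous_pair : Continuous (fun x : X × X => pair x.1 x.2) := by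
  refine Continuous.subtype_mk (continuous_generateFrom_iff.2 ?_) _
  rintro _ ⟨Ps, hPs, rfl⟩
  have : IsOpen (((⋃₀ (Ps : Set (Set X))) ×ˢ (⋃₀ (Ps : Set (Set X)))) ∩
      ⋂ P ∈ Ps, ((Prod.fst ⁻¹' P) ∪ (Prod.snd ⁻¹' P) : Set (X × X))) := by
    have h0 : IsOpen (⋃₀ (Ps : Set (Set X))) := isOpen_sUnion hPs
    refine (h0.prod h0).inter (isOpen_biInter_finset fun P hP => ?_)
    exact ((hPs P hP).preimage continuous_fst).union ((hPs P hP).preimage continuous_snd)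
  convert this using 1
  ext ⟨a, b⟩
  simp only [VHyper.vbox, mem_preimage, mem_ofPred_eq, mem_inter_iff, mem_prod, mem_iInter,
    mem_union, insert_subset_iff, singleton_subset_iff]
  refine and_congr Iff.rfl (forall₂_congr fun P hP => ?_)
  constructor
  · rintro ⟨c, (rfl | rfl), hc⟩
    · exact Or.inl hc
    · exact Or.inr hc
  · rintro (h | h)
    · exact ⟨a, by simp, h⟩
    · exact ⟨b, by simp, h⟩

/-! fan -/

def fp : SeqFanOmega := Quotient.mk fanSetoid (0, OnePoint.infty)
def fy (n m : ℕ) : SeqFanOmega := Quotient.mk fanSetoid (n, (m : OnePoint ℕ))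

lemma mk_infty (n : ℕ) : Quotient.mk fanSetoid (n, OnePoint.infty) = fp :=
  Quotient.sound (Or.inr ⟨rfl, rfl⟩)

lemma fan_cases (a : SeqFanOmega) : a = fp ∨ ∃ n m, a = fy n m := by
  induction a using Quotient.inductionOn with
  | h a =>
    obtain ⟨n, t⟩ := a
    induction t using OnePoint.rec with
    | infty => exact Or.inl (mk_infty n)
    | coe m => exact Or.inr ⟨n, m, rfl⟩

lemma fy_ne (n m : ℕ) : fy n m ≠ fp := by
  intro h
  rcases Quotient.exact h with h | ⟨h, _⟩
  · simp at h
  · simp at h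

lemma fy_inj {n m n' m' : ℕ} (h : fy n m = fy n' m') : n = n' ∧ m = m' := by
  rcases Quotient.exact h with h | ⟨h, _⟩
  · simpa using h
  · simp at h

lemma fan_open {V : Set SeqFanOmega} (h : fp ∈ V → ∀ n, {m | fy n m ∉ V}.Finite) : IsOpen V := by
  refine isOpen_coinduced.2 ?_
  have : {a : ℕ × OnePoint ℕ | (Quotient.mk fanSetoid a : SeqFanOmega) ∈ V} =
      ⋃ n, ({n} : Set ℕ) ×ˢ {t : OnePoint ℕ | (Quotient.mk fanSetoid (n, t) : SeqFanOmega) ∈ V} := by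
    ext ⟨n, t⟩
    simp
  change IsOpen {a : ℕ × OnePoint ℕ | (Quotient.mk fanSetoid a : SeqFanOmega) ∈ V}
  rw [this]
  refine isOpen_iUnion fun n => (isOpen_discrete _).prod ?_
  rw [OnePoint.isOpen_def]
  refine ⟨fun hi => ?_, isOpen_discrete _⟩
  have hi' : fp ∈ V := by rw [← mk_infty n]; exact hi
  exact (h hi' n).isCompact

lemma fan_tendsto (n : ℕ) : Tendsto (fy n) atTop (𝓝 fp) := by
  have hc : Continuous (fun t : OnePoint ℕ => (Quotient.mk fanSetoid (n, t) : SeqFanOmega)) := by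
    have : Continuous (Quotient.mk fanSetoid : _ → SeqFanOmega) := continuous_coinduced_rng
    exact this.comp (by fun_prop)
  have h1 := hc.tendsto OnePoint.infty
  rw [mk_infty] at h1
  have h2 : Tendsto (fun m : ℕ => (m : OnePoint ℕ)) atTop (𝓝 OnePoint.infty) := by
    have := OnePoint.tendsto_coe_infty (X := ℕ)
    rwa [Filter.coclosedCompact_eq_cocompact, Filter.cocompact_eq_cofinite,
      Nat.cofinite_eq_atTop] at this
  exact h1.comp h2

lemma arens_cases (c : Arens) : c = Arens.pt ∨ (∃ n, c = Arens.x n) ∨ ∃ n m, c = Arens.xx n m := by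
  rcases c with _ | ⟨n, t⟩
  · exact Or.inl rfl
  · induction t using OnePoint.rec with
    | infty => exact Or.inr (Or.inl ⟨n, rfl⟩)
    | coe m => exact Or.inr (Or.inr ⟨n, m, rfl⟩)

lemma arens_open {U : Set Arens} : IsOpen U ↔ Arens.ArensOpen U := Iff.rfl

lemma xx_tendsto (n : ℕ) : Tendsto (Arens.xx n) atTop (𝓝 (Arens.x n)) := by
  rw [tendsto_nhds]
  intro U hU hx
  have := (arens_open.1 hU).1 n hx
  rw [← Nat.cofinite_eq_atTop]
  exact this

lemma arens_cont {Y : Type*} [TopologicalSpace Y] {g : Arens → Y}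
    (h1 : ∀ n, Tendsto (fun m => g (Arens.xx n m)) atTop (𝓝 (g (Arens.x n))))
    (h2 : Tendsto (fun n => g (Arens.x n)) atTop (𝓝 (g Arens.pt))) : Continuous g := by
  refine ⟨fun U hU => arens_open.2 ⟨fun n hn => ?_, fun hp => ?_⟩⟩
  · have := (h1 n).eventually (hU.mem_nhds hn)
    rw [← Nat.cofinite_eq_atTop] at this
    exact this
  · obtain ⟨k, hk⟩ := eventually_atTop.1 (h2.eventually (hU.mem_nhds hp))
    exact ⟨k, fun n hn => hk n hn.le⟩

def gm (q : X) (z : ℕ → ℕ → X) (c : Arens) : VFin2 X :=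
  Option.elim (α := ℕ × OnePoint ℕ) c (pair q q)
    (fun a => pair (z 0 a.1) (OnePoint.elim a.2 q (z (a.1 + 1))))

lemma gm_pt (q : X) (z : ℕ → ℕ → X) : gm q z Arens.pt = pair q q := rfl
lemma gm_x (q : X) (z : ℕ → ℕ → X) (n : ℕ) : gm q z (Arens.x n) = pair (z 0 n) q := rfl
lemma gm_xx (q : X) (z : ℕ → ℕ → X) (n m : ℕ) :
    gm q z (Arens.xx n m) = pair (z 0 n) (z (n + 1) m) := rfl

lemma pair_eq {a b c d : X} (h : pair a b = pair c d) :
    (a = c ∧ b = d) ∨ (a = d ∧ b = c) := by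
  have := congrArg (fun A : VFin2 X => A.1.carrier) h
  simp only [pair_carrier] at this
  exact Set.pair_eq_pair_iff.1 this

lemma main [T2Space X] {f : SeqFanOmega → X} (hf : IsClosedEmbedding f) :
    IsClosedEmbedding (gm (f fp) (fun n m => f (fy n m))) := by
  set q := f fp with hq
  set z : ℕ → ℕ → X := fun n m => f (fy n m) with hz
  have zq : ∀ n m, z n m ≠ q := fun n m h => fy_ne n m (hf.injective h)
  have qz : ∀ n m, q ≠ z n m := fun n m h => zq n m h.symm
  have zi : ∀ {n m n' m'}, z n m = z n' m' → n = n' ∧ m = m' :=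
    fun h => fy_inj (hf.injective h)
  have zt : ∀ n, Tendsto (z n) atTop (𝓝 q) := fun n =>
    (hf.continuous.tendsto fp).comp (fan_tendsto n)
  have hcont : Continuous (gm q z) := by
    refine arens_cont (fun n => ?_) ?_
    · simp only [gm_xx, gm_x]
      exact (continuous_pair.tendsto (z 0 n, q)).comp (tendsto_const_nhds.prodMk_nhds (zt (n+1)))
    · simp only [gm_pt, gm_x]
      exact (continuous_pair.tendsto (q, q)).comp ((zt 0).prodMk_nhds tendsto_const_nhds)
  have hinj : Function.Injective (gm q z) := by
    intro c d h
    rcases arens_cases c with rfl | ⟨n, rfl⟩ | ⟨n, m, rfl⟩ <;>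
    rcases arens_cases d with rfl | ⟨n', rfl⟩ | ⟨n', m', rfl⟩
    try rfl
    all_goals
    simp only [gm_pt, gm_x, gm_xx] at h <;>
    rcases pair_eq h with ⟨h1, h2⟩ | ⟨h1, h2⟩ <;>
    first
    | rfl
    | exact absurd h1 (zq _ _)
    | exact absurd h2 (zq _ _)
    | exact absurd h1 (qz _ _)
    | exact absurd h2 (qz _ _)
    | (have h1 := zi h1; have h2 := zi h2; obtain ⟨-, rfl⟩ := h1; obtain ⟨-, rfl⟩ := h2; rfl)
    | (have h1 := zi h1; omega)
    | (have h1 := zi h1; obtain ⟨-, rfl⟩ := h1; rfl)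
  -- points of the image lie in the range of `f`
  have hsub : ∀ c, (gm q z c).1.carrier ⊆ range f := by
    intro c
    rcases arens_cases c with rfl | ⟨n, rfl⟩ | ⟨n, m, rfl⟩ <;>
    simp only [gm_pt, gm_x, gm_xx, pair_carrier, insert_subset_iff, singleton_subset_iff] <;>
    exact ⟨⟨_, rfl⟩, ⟨_, rfl⟩⟩
  let K : ℕ → Set Arens := fun n => insert (Arens.x n) (range (Arens.xx n))
  have hK : ∀ n, IsCompact (K n) := fun n => (xx_tendsto n).isCompact_insert_range
  -- the key case
  have key : ∀ (C : Set Arens), IsClosed C → ∀ A : VFin2 X, A ∉ gm q z '' C → ∀ a b n,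
      z a b ∈ A.1.carrier → (∀ c, z a b ∈ (gm q z c).1.carrier → c ∈ K n) →
      ∃ W, IsOpen W ∧ A ∈ W ∧ ∀ c ∈ C, gm q z c ∉ W := by
    intro C hC A hA a b n hab hc
    have hcl : IsClosed (f '' {fy a b}ᶜ) := by
      refine hf.isClosedMap _ ?_
      rw [isClosed_compl_iff]
      exact fan_open fun h => absurd h.symm (fy_ne a b)
    have hcp : IsClosed (gm q z '' (K n ∩ C)) :=
      (((hK n).inter_right hC).image hcont).isClosed
    refine ⟨_, (isOpen_hit hcl.isOpen_compl).inter hcp.isOpen_compl, ⟨⟨_, hab, ?_⟩, ?_⟩, ?_⟩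
    · rintro ⟨s, hs, h⟩
      exact hs (hf.injective h)
    · exact fun h => hA (image_mono inter_subset_right h)
    · rintro c hcC ⟨⟨w, hw, hwn⟩, h2⟩
      obtain ⟨s, rfl⟩ := hsub c hw
      have hs : s = fy a b := by
        by_contra hs
        exact hwn ⟨s, hs, rfl⟩
      subst hs
      exact h2 ⟨c, ⟨hc c hw, hcC⟩, rfl⟩
  refine IsClosedEmbedding.of_continuous_injective_isClosedMap hcont hinj ?_
  intro C hC
  rw [← isOpen_compl_iff, isOpen_iff_forall_mem_open]
  intro A hA
  suffices ∃ W, IsOpen W ∧ A ∈ W ∧ ∀ c ∈ C, gm q z c ∉ W by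
    obtain ⟨W, hW, hAW, h⟩ := this
    refine ⟨W, ?_, hW, hAW⟩
    rintro B hB ⟨c, hc, rfl⟩
    exact h c hc hB
  by_cases h1 : A.1.carrier ⊆ range f
  swap
  · obtain ⟨a, ha, har⟩ := not_subset.1 h1
    refine ⟨_, isOpen_hit hf.isClosed_range.isOpen_compl, ⟨a, ha, har⟩, ?_⟩
    rintro c - ⟨w, hw, hwn⟩
    exact hwn (hsub c hw)
  by_cases h2 : A.1.carrier = {q}
  · have hpt : Arens.pt ∉ C := fun h => hA ⟨_, h, ext2 (by rw [gm_pt, pair_carrier, h2]; simp)⟩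
    obtain ⟨o1, o2⟩ := arens_open.1 hC.isOpen_compl
    obtain ⟨k, hk⟩ := o2 hpt
    let D : Set SeqFanOmega := {s | (∃ n ≤ k, s = fy 0 n) ∨
      ∃ n > k, ∃ m, Arens.xx n m ∈ C ∧ s = fy (n + 1) m}
    have hD : IsClosed D := by
      rw [← isOpen_compl_iff]
      refine fan_open fun _ n => ?_
      simp only [mem_compl_iff, not_not]
      rcases n with _ | n
      · refine (finite_le_nat k).subset ?_
        rintro m (⟨n, hn, h⟩ | ⟨n, hn, m', hm', h⟩)
        · rw [mem_ofPred_eq, (fy_inj h).2]; exact hn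
        · have := (fy_inj h).1; omega
      · by_cases hn : n > k
        · refine (o1 n (hk n hn)).subset ?_
          rintro m (⟨n', hn', h⟩ | ⟨n', hn', m', hm', h⟩)
          · have := (fy_inj h).1; omega
          · obtain ⟨e1, rfl⟩ := fy_inj h
            obtain rfl : n = n' := by omega
            simpa using hm'
        · refine Set.finite_empty.subset ?_
          rintro m (⟨n', hn', h⟩ | ⟨n', hn', m', hm', h⟩)
          · have := (fy_inj h).1; omega
          · have := (fy_inj h).1; omega
    refine ⟨_, isOpen_sub (hf.isClosedMap _ hD).isOpen_compl, ?_, ?_⟩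
    · rw [mem_ofPred_eq, h2, singleton_subset_iff]
      rintro ⟨s, hs, h⟩
      have := hf.injective h
      subst this
      rcases hs with ⟨n, _, h⟩ | ⟨n, _, m, _, h⟩ <;> exact fy_ne _ _ h.symm
    · intro c hc hW
      rcases arens_cases c with rfl | ⟨n, rfl⟩ | ⟨n, m, rfl⟩
      · exact hpt hc
      · rw [mem_ofPred_eq, gm_x, pair_carrier, insert_subset_iff] at hW
        refine hW.1 ⟨_, Or.inl ⟨n, ?_, rfl⟩, rfl⟩
        by_contra hn
        exact hk n (by omega) hc
      · rw [mem_ofPred_eq, gm_xx, pair_carrier, insert_subset_iff, singleton_subset_iff] at hW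
        by_cases hn : n > k
        · exact hW.2 ⟨_, Or.inr ⟨n, hn, m, hc, rfl⟩, rfl⟩
        · exact hW.1 ⟨_, Or.inl ⟨n, by omega, rfl⟩, rfl⟩
  · have : ∃ a b, z a b ∈ A.1.carrier := by
      by_contra! hno
      apply h2
      rw [Set.eq_singleton_iff_nonempty_unique_mem]
      refine ⟨A.1.nonempty', fun w hw => ?_⟩
      obtain ⟨s, rfl⟩ := h1 hw
      rcases fan_cases s with rfl | ⟨n, m, rfl⟩
      · rfl
      · exact absurd hw (hno n m)
    obtain ⟨a, b, hab⟩ := this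
    refine key C hC A hA a b (if a = 0 then b else a - 1) hab ?_
    intro c hc
    rcases arens_cases c with rfl | ⟨n, rfl⟩ | ⟨n, m, rfl⟩
    · simp [gm_pt, pair_carrier, zq] at hc
    · simp only [gm_x, pair_carrier, mem_insert_iff, mem_singleton_iff, zq, or_false] at hc
      obtain ⟨rfl, rfl⟩ := zi hc
      exact Or.inl rfl
    · simp only [gm_xx, pair_carrier, mem_insert_iff, mem_singleton_iff] at hc
      rcases hc with hc | hc
      · obtain ⟨rfl, rfl⟩ := zi hc
        exact Or.inr ⟨m, rfl⟩
      · obtain ⟨rfl, rfl⟩ := zi hc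
        exact Or.inr ⟨b, rfl⟩

end S5

/-- If `X` contains a closed copy of the sequential fan `S_ω`, then `ℱ₂(X)` contains a
closed copy of the Arens space `S₂`. -/
theorem statement5 {X : Type*} [TopologicalSpace X] [T2Space X] [RegularSpace X]
    (h : ∃ f : SeqFanOmega → X, Topology.IsClosedEmbedding f) :
    ∃ g : Arens → VFin2 X, Topology.IsClosedEmbedding g := by
  obtain ⟨f, hf⟩ := h
  exact ⟨_, S5.main hf⟩
end

section
/- Let X be a regular T2 space containing a closed copy of the Arens space S₂. Then the hyperspace 𝒦(X) with the Vietoris topology contains a closed copy of the sequential fan S_ω. -/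
open TopologicalSpace Set

namespace FanAux

open Filter Topology

def j (p : ℕ × OnePoint ℕ) : Arens := some p

theorem j_inj : Function.Injective j := fun _ _ h => Option.some.inj h

theorem arens_isOpen {U : Set Arens} : IsOpen U ↔ Arens.ArensOpen U := Iff.rfl

theorem op_isOpen {s : Set (OnePoint ℕ)} :
    IsOpen s ↔ (OnePoint.infty ∈ s → {m : ℕ | (m : OnePoint ℕ) ∈ s}ᶜ.Finite) := by
  rw [OnePoint.isOpen_def]
  constructor
  · intro h hs
    exact (h.1 hs).finite_of_discrete
  · intro h
    exact ⟨fun hs => (h hs).isCompact, isOpen_discrete _⟩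

theorem j_cont : Continuous j := by
  rw [continuous_prod_of_discrete_left]
  intro n
  refine ⟨fun U hU => ?_⟩
  rw [op_isOpen]
  exact (arens_isOpen.1 hU).1 n

/-- the limit sequence -/
def C : Set Arens := insert Arens.pt (range Arens.x)

theorem C_compact : IsCompact C := by
  apply Tendsto.isCompact_insert_range
  rw [tendsto_nhds]
  intro U hU hp
  obtain ⟨k, hk⟩ := (arens_isOpen.1 hU).2 hp
  filter_upwards [eventually_gt_atTop k] with n hn using hk n hn

theorem inf_mem_C (n : ℕ) : j (n, OnePoint.infty) ∈ C := Or.inr ⟨n, rfl⟩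

theorem coe_notMem_C (n m : ℕ) : j (n, (m : OnePoint ℕ)) ∉ C := by
  rintro (h | ⟨k, h⟩)
  · exact Option.some_ne_none _ h
  · have := congrArg Prod.snd (Option.some.inj h)
    exact OnePoint.infty_ne_coe m this

theorem cases_notC {a : Arens} (ha : a ∉ C) : ∃ n m : ℕ, a = j (n, (m : OnePoint ℕ)) := by
  rcases a with _ | ⟨n, m⟩
  · exact absurd (Or.inl rfl) ha
  · induction m using OnePoint.rec with
    | infty => exact absurd (inf_mem_C n) ha
    | coe m => exact ⟨n, m, rfl⟩

theorem isOpen_single {a : Arens} (ha : a ∉ C) : IsOpen ({a} : Set Arens) := by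
  rw [arens_isOpen]
  constructor
  · intro n hn
    exact absurd (hn ▸ inf_mem_C n) ha
  · intro hn
    exact absurd (hn ▸ Or.inl rfl) ha

variable {X : Type*} [TopologicalSpace X]

theorem vext {K L : VHyper X} (h : K.carrier = L.carrier) : K = L := by
  obtain ⟨a, _, _⟩ := K
  obtain ⟨b, _, _⟩ := L
  obtain rfl : a = b := h
  rfl

theorem isOpen_sub {U : Set X} (hU : IsOpen U) : IsOpen {K : VHyper X | K.carrier ⊆ U} := by
  classical
  apply isOpen_generateFrom_of_mem
  refine ⟨{U}, by simpa using hU, ?_⟩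
  ext K
  simp only [VHyper.vbox, mem_ofPred_eq, Finset.coe_singleton, sUnion_singleton,
    Finset.mem_singleton, forall_eq]
  refine ⟨fun h => ⟨h, ?_⟩, fun h => h.1⟩
  rw [inter_eq_left.2 h]
  exact K.nonempty'

theorem isOpen_meet {U : Set X} (hU : IsOpen U) :
    IsOpen {K : VHyper X | (K.carrier ∩ U).Nonempty} := by
  classical
  apply isOpen_generateFrom_of_mem
  refine ⟨{U, univ}, by simpa using hU, ?_⟩
  ext K
  simp only [VHyper.vbox, mem_ofPred_eq, Finset.coe_insert, Finset.coe_singleton,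
    Finset.mem_insert, Finset.mem_singleton, forall_eq_or_imp, forall_eq]
  refine ⟨fun h => ⟨by simp, h, by simpa using K.nonempty'⟩, fun h => h.2.1⟩

def g0 (f : Arens → X) (hf : Continuous f) (p : ℕ × OnePoint ℕ) : VHyper X where
  carrier := f '' (insert (j p) C)
  isCompact' := (C_compact.insert _).image hf
  nonempty' := ⟨_, mem_image_of_mem f (mem_insert _ _)⟩

theorem g0_cont (f : Arens → X) (hf : Continuous f) : Continuous (g0 f hf) := by
  rw [continuous_generateFrom_iff]
  rintro S ⟨Ps, hPs, rfl⟩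
  have hfj : Continuous fun p => f (j p) := hf.comp j_cont
  have : g0 f hf ⁻¹' VHyper.vbox Ps =
      {p | (g0 f hf p).carrier ⊆ ⋃₀ (Ps : Set (Set X))} ∩
      ⋂ P ∈ Ps, {p | ((g0 f hf p).carrier ∩ P).Nonempty} := by
    ext p; simp [VHyper.vbox]
  rw [this]
  apply IsOpen.inter
  · have hU : IsOpen (⋃₀ (Ps : Set (Set X))) := isOpen_sUnion fun U h => hPs U h
    by_cases hC : f '' C ⊆ ⋃₀ (Ps : Set (Set X))
    · convert hU.preimage hfj using 1
      ext p
      simp only [g0, image_insert_eq, insert_subset_iff, mem_ofPred_eq, mem_preimage, hC, and_true]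
    · convert isOpen_empty using 1
      ext p
      simp only [g0, image_insert_eq, insert_subset_iff, mem_ofPred_eq, hC, and_false,
        mem_empty_iff_false]
  · apply isOpen_biInter_finset
    intro P hP
    by_cases hC : (f '' C ∩ P).Nonempty
    · convert isOpen_univ using 1
      ext p
      simp only [mem_ofPred_eq, mem_univ, iff_true]
      refine hC.mono (inter_subset_inter_left _ ?_)
      exact image_mono (subset_insert _ _)
    · convert (hPs P hP).preimage hfj using 1
      ext p
      simp only [g0, image_insert_eq, mem_ofPred_eq, mem_preimage]
      constructor
      · rintro ⟨y, rfl | hy, hyP⟩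
        · exact hyP
        · exact absurd ⟨y, hy, hyP⟩ hC
      · intro h
        exact ⟨_, Or.inl rfl, h⟩

theorem g0_resp (f : Arens → X) (hf : Continuous f) (p q : ℕ × OnePoint ℕ)
    (h : fanSetoid.r p q) : g0 f hf p = g0 f hf q := by
  rcases h with rfl | ⟨h1, h2⟩
  · rfl
  · obtain ⟨n, a⟩ := p
    obtain ⟨k, b⟩ := q
    dsimp at h1 h2
    subst h1 h2
    simp only [g0, insert_eq_of_mem (inf_mem_C _)]

def g (f : Arens → X) (hf : Continuous f) : SeqFanOmega → VHyper X :=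
  Quotient.lift (g0 f hf) (g0_resp f hf)

def mk (p : ℕ × OnePoint ℕ) : SeqFanOmega := Quotient.mk fanSetoid p

theorem g_mk (f : Arens → X) (hf : Continuous f) (p) : g f hf (mk p) = g0 f hf p := rfl

theorem mk_surj (q : SeqFanOmega) : ∃ p, mk p = q := Quotient.exists_rep q

theorem g_cont (f : Arens → X) (hf : Continuous f) : Continuous (g f hf) := by
  refine continuous_coinduced_dom.2 ?_
  exact g0_cont f hf

/-- The key set-level fact. -/
theorem mk_eq {p q : ℕ × OnePoint ℕ} (h : j p ∈ insert (j q) C) (h' : j q ∈ insert (j p) C) :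
    mk p = mk q := by
  apply Quotient.sound
  rcases h with h | h
  · exact Or.inl (j_inj h)
  · have key : ∀ r, j r ∈ C → r.2 = OnePoint.infty := by
      rintro ⟨n, m⟩ hr
      induction m using OnePoint.rec with
      | infty => rfl
      | coe m => exact absurd hr (coe_notMem_C n m)
    rcases h' with h' | h'
    · exact Or.inl (j_inj h').symm
    · exact Or.inr ⟨key _ h, key _ h'⟩

theorem g_inj (f : Arens → X) (hf : Continuous f) (hi : Function.Injective f) :
    Function.Injective (g f hf) := by
  intro a b hab
  obtain ⟨p, rfl⟩ := mk_surj a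
  obtain ⟨q, rfl⟩ := mk_surj b
  have h := hi.image_injective (congrArg VHyper.carrier hab)
  exact mk_eq (h ▸ mem_insert _ _) (h ▸ mem_insert _ _)

theorem g_closed [T1Space X] (f : Arens → X) (hf : IsClosedEmbedding f) :
    IsClosedMap (g f hf.continuous) := by
  intro F hF
  have hi := hf.injective
  -- isolating open sets
  have iso : ∀ a, a ∉ C → ∃ U : Set X, IsOpen U ∧ f ⁻¹' U = {a} := fun a ha =>
    hf.isInducing.isOpen_iff.1 (isOpen_single ha)
  rw [← isOpen_compl_iff, isOpen_iff_forall_mem_open]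
  intro L hL
  suffices H : ∃ N : Set (VHyper X), IsOpen N ∧ L ∈ N ∧
      ∀ p, mk p ∈ F → g0 f hf.continuous p ∉ N by
    obtain ⟨N, hN, hLN, h⟩ := H
    refine ⟨N, ?_, hN, hLN⟩
    rintro K hK ⟨a, ha, rfl⟩
    obtain ⟨p, rfl⟩ := mk_surj a
    exact h p ha hK
  by_cases h1 : f '' C ⊆ L.carrier
  swap
  · obtain ⟨c, hc, hcL⟩ := not_subset.1 h1
    refine ⟨_, isOpen_sub (isOpen_compl_singleton (x := c)),
      subset_compl_singleton_iff.2 hcL, fun p _ hN => ?_⟩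
    exact hN (image_mono (subset_insert _ _) hc) rfl
  by_cases h2 : L.carrier ⊆ range f
  swap
  · obtain ⟨c, hcL, hc⟩ := not_subset.1 h2
    refine ⟨_, isOpen_meet hf.isClosed_range.isOpen_compl, ⟨c, hcL, hc⟩, ?_⟩
    rintro p _ ⟨y, ⟨z, _, rfl⟩, hy⟩
    exact hy ⟨z, rfl⟩
  by_cases h3 : ∃ a, a ∉ C ∧ f a ∈ L.carrier
  · obtain ⟨a, haC, haL⟩ := h3
    obtain ⟨U, hU, hUa⟩ := iso a haC
    have haU : f a ∈ U := by
      have : a ∈ f ⁻¹' U := hUa ▸ rfl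
      exact this
    have hmeet : ∀ p, (f '' (insert (j p) C) ∩ U).Nonempty → a = j p := by
      rintro p ⟨y, ⟨z, hz, rfl⟩, hy⟩
      have : z = a := by
        have : z ∈ f ⁻¹' U := hy
        rw [hUa] at this; exact this
      subst this
      exact hz.resolve_right haC
    by_cases h4 : ∃ b, b ∉ C ∧ f b ∈ L.carrier ∧ b ≠ a
    · obtain ⟨b, hbC, hbL, hba⟩ := h4
      obtain ⟨V, hV, hVb⟩ := iso b hbC
      have hbV : f b ∈ V := by
        have : b ∈ f ⁻¹' V := hVb ▸ rfl
        exact this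
      refine ⟨_, (isOpen_meet hU).inter (isOpen_meet hV), ⟨⟨_, haL, haU⟩, ⟨_, hbL, hbV⟩⟩, ?_⟩
      rintro p _ ⟨hp1, y, ⟨z, hz, rfl⟩, hy⟩
      have : z = b := by
        have : z ∈ f ⁻¹' V := hy
        rw [hVb] at this; exact this
      subst this
      exact hba ((hz.resolve_right hbC).trans (hmeet p hp1).symm)
    · push Not at h4
      refine ⟨_, isOpen_meet hU, ⟨_, haL, haU⟩, ?_⟩
      intro p hpF hp
      apply hL
      refine ⟨mk p, hpF, ?_⟩
      have hap := hmeet p hp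
      have hc : f '' (insert (j p) C) = L.carrier := by
        apply Subset.antisymm
        · rw [image_insert_eq, insert_subset_iff, ← hap]
          exact ⟨haL, h1⟩
        · intro y hy
          obtain ⟨z, rfl⟩ := h2 hy
          refine mem_image_of_mem f ?_
          by_cases hz : z ∈ C
          · exact Or.inr hz
          · exact Or.inl ((h4 z hz hy).trans hap)
      exact vext hc
  · push Not at h3
    have hLC : L.carrier = f '' C := by
      apply Subset.antisymm _ h1
      intro y hy
      obtain ⟨z, rfl⟩ := h2 hy
      by_contra hz
      exact h3 z (fun h => hz (mem_image_of_mem f h)) hy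
    have hinf : ∀ n : ℕ, mk (n, OnePoint.infty) ∉ F := by
      intro n hn
      apply hL
      refine ⟨_, hn, ?_⟩
      apply vext
      rw [g_mk]
      simp only [g0, insert_eq_of_mem (inf_mem_C _)]
      exact hLC.symm
    have hG : IsOpen (mk ⁻¹' Fᶜ) := isOpen_coinduced.1 hF.isOpen_compl
    have hW : IsOpen (C ∪ j '' (mk ⁻¹' Fᶜ)) := by
      rw [arens_isOpen]
      constructor
      · intro n _
        have hs : IsOpen ((fun m : OnePoint ℕ => (n, m)) ⁻¹' (mk ⁻¹' Fᶜ)) :=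
          hG.preimage (by fun_prop)
        refine (op_isOpen.1 hs (hinf n)).subset ?_
        intro m hm hm'
        exact hm (Or.inr ⟨_, hm', rfl⟩)
      · intro _
        exact ⟨0, fun n _ => Or.inl (inf_mem_C n)⟩
    obtain ⟨U, hU, hUW⟩ := hf.isInducing.isOpen_iff.1 hW
    refine ⟨_, isOpen_sub hU, ?_, ?_⟩
    · change L.carrier ⊆ U
      rw [hLC, image_subset_iff, hUW]
      exact subset_union_left
    · intro p hpF hp
      have hjp : j p ∈ f ⁻¹' U := hp (mem_image_of_mem f (mem_insert _ _))
      rw [hUW] at hjp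
      rcases hjp with h | ⟨q, hq, hqp⟩
      · obtain ⟨n, m⟩ := p
        induction m using OnePoint.rec with
        | infty => exact hinf n hpF
        | coe m => exact coe_notMem_C n m h
      · rw [j_inj hqp] at hq
        exact hq hpF

end FanAux

/-- If `X` contains a closed copy of the Arens space `S₂`, then `𝒦(X)` contains a closed
copy of the sequential fan `S_ω`. -/
theorem statement7 {X : Type*} [TopologicalSpace X] [T2Space X] [RegularSpace X]
    (h : ∃ f : Arens → X, Topology.IsClosedEmbedding f) :
    ∃ g : SeqFanOmega → VHyper X, Topology.IsClosedEmbedding g := by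
  obtain ⟨f, hf⟩ := h
  exact ⟨FanAux.g f hf.continuous, Topology.IsClosedEmbedding.of_continuous_injective_isClosedMap
    (FanAux.g_cont f hf.continuous) (FanAux.g_inj f hf.continuous hf.injective)
    (FanAux.g_closed f hf)⟩
end
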